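/- (Main theorem, nondefectivity.) Let G act on ℂ^D with ℂ^D an irreducible G-module, and let V ⊆ ℂ^D be an irreducible Zariski-closed G-invariant cone with V ≠ {0} and dim V = N for a natural number N. Then for every m ≥ 1 with N * (m + N) ≤ D, the m-th secant variety σ_m V has dimension exactly m * N. -/

import Mathlib

noncomputable section

/-- The Zariski topology on `ι → ℂ`: a set is closed iff it is the common zero locus
of a family of polynomials in `MvPolynomial ι ℂ`. -/
def zt (ι : Type*) : TopologicalSpace (ι → ℂ) :=
  TopologicalSpace.generateFrom
    { U | ∃ f : MvPolynomial ι ℂ, U = { x | MvPolynomial.eval x f ≠ 0 } }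

def zIsClosed {ι : Type*} (S : Set (ι → ℂ)) : Prop := @IsClosed _ (zt ι) S

def zIsIrreducible {ι : Type*} (S : Set (ι → ℂ)) : Prop := @IsIrreducible _ (zt ι) S

def zClosure {ι : Type*} (S : Set (ι → ℂ)) : Set (ι → ℂ) := @closure _ (zt ι) S

/-- The topological Krull dimension of `S` (with the subspace Zariski topology):
the supremum of lengths of chains of irreducible closed subsets. -/
def zDim {ι : Type*} (S : Set (ι → ℂ)) : WithBot ℕ∞ :=
  @topologicalKrullDim ↥S (TopologicalSpace.induced Subtype.val (zt ι))

/-- The `m`-th secant variety: the Zariski closure of the set of sums of `m` points of `V`. -/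
def secant {ι : Type*} (m : ℕ) (V : Set (ι → ℂ)) : Set (ι → ℂ) :=
  zClosure { p | ∃ x : Fin m → (ι → ℂ), (∀ i, x i ∈ V) ∧ p = ∑ i, x i }

/-- `ℂ^D` is an irreducible `G`-module (through `ρ`). -/
def IsIrreducibleGModule {D : ℕ} {G : Type*} [Group G]
    (ρ : G →* ((Fin D → ℂ) ≃ₗ[ℂ] (Fin D → ℂ))) : Prop :=
  1 ≤ D ∧ ∀ W : Submodule ℂ (Fin D → ℂ),
    (∀ g : G, ∀ x ∈ W, ρ g x ∈ W) → W = ⊥ ∨ W = ⊤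

open Module TensorProduct

/-- A set of tuples is separately open if all its one-variable slices are open. -/
def SepOpen {ι X : Type*} [DecidableEq ι] [TopologicalSpace X] (O : Set (ι → X)) : Prop :=
  ∀ (x : ι → X) (i : ι), IsOpen {v | Function.update x i v ∈ O}

namespace SepOpen

variable {ι X : Type*} [DecidableEq ι] [TopologicalSpace X]

theorem inter {O₁ O₂ : Set (ι → X)} (h₁ : SepOpen O₁) (h₂ : SepOpen O₂) : SepOpen (O₁ ∩ O₂) :=
  fun x i => (h₁ x i).inter (h₂ x i)

theorem univ : SepOpen (Set.univ : Set (ι → X)) := fun x i => by simp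

theorem inter_nonempty [Finite ι] [PreirreducibleSpace X] {O₁ O₂ : Set (ι → X)}
    (h₁ : SepOpen O₁) (h₂ : SepOpen O₂) (n₁ : O₁.Nonempty) (n₂ : O₂.Nonempty) :
    (O₁ ∩ O₂).Nonempty := by
  cases nonempty_fintype ι
  have key : ∀ (s : Finset ι) (p q : ι → X), p ∈ O₁ → q ∈ O₂ → (∀ i ∉ s, p i = q i) →
      (O₁ ∩ O₂).Nonempty := by
    intro s
    induction s using Finset.induction_on with
    | empty =>
      intro p q hp hq h
      obtain rfl : p = q := funext fun i => h i (by simp)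
      exact ⟨p, hp, hq⟩
    | insert a s ha ih =>
      intro p q hp hq h
      obtain ⟨v, hv₁, hv₂⟩ := nonempty_preirreducible_inter (h₁ p a) (h₂ q a)
        ⟨p a, by simpa using hp⟩ ⟨q a, by simpa using hq⟩
      refine ih _ _ hv₁ hv₂ fun i hi => ?_
      by_cases hia : i = a
      · subst hia; simp
      · simpa [hia] using h i (by simp [hia, hi])
  obtain ⟨p, hp⟩ := n₁
  obtain ⟨q, hq⟩ := n₂
  exact key Finset.univ p q hp hq (by simp)

theorem biInter {α : Type*} [Finite ι] [PreirreducibleSpace X] [Nonempty X] (s : Finset α)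
    (O : α → Set (ι → X)) (h : ∀ a ∈ s, SepOpen (O a)) (n : ∀ a ∈ s, (O a).Nonempty) :
    SepOpen (⋂ a ∈ s, O a) ∧ (⋂ a ∈ s, O a).Nonempty := by
  classical
  induction s using Finset.induction_on with
  | empty => simpa using SepOpen.univ
  | insert a s ha ih =>
    obtain ⟨h', n'⟩ := ih (fun b hb => h b (by simp [hb])) (fun b hb => n b (by simp [hb]))
    rw [Finset.set_biInter_insert]
    exact ⟨(h a (by simp)).inter h', (h a (by simp)).inter_nonempty h' (n a (by simp)) n'⟩

end SepOpen

section TangentSums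

theorem map_equivFin_symm_univ {ι : Type*} (I : Finset ι) :
    (Finset.univ : Finset (Fin I.card)).map
      (I.equivFin.symm.toEmbedding.trans (Function.Embedding.subtype _)) = I := by
  ext i
  simp only [Finset.mem_map, Finset.mem_univ, true_and, Function.Embedding.trans_apply,
    Equiv.coe_toEmbedding, Function.Embedding.coe_subtype]
  exact ⟨by rintro ⟨a, rfl⟩; exact (I.equivFin.symm a).2, fun h => ⟨I.equivFin ⟨i, h⟩, by simp⟩⟩

variable {k E X ι : Type*} [Field k] [AddCommGroup E] [Module k E]

/-- The sum of the subspaces attached to the members of a tuple indexed by `I`. -/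
def tupleSup (T : X → Submodule k E) (x : ι → X) (I : Finset ι) : Submodule k E :=
  ⨆ i ∈ I, T (x i)

theorem tupleSup_insert [DecidableEq ι] (T : X → Submodule k E) (x : ι → X) (I : Finset ι)
    (i : ι) : tupleSup T x (insert i I) = T (x i) ⊔ tupleSup T x I :=
  Finset.iSup_insert i I fun j => T (x j)

theorem tupleSup_mono (T : X → Submodule k E) (x : ι → X) {I J : Finset ι} (h : I ⊆ J) :
    tupleSup T x I ≤ tupleSup T x J :=
  biSup_mono fun _ hi => h hi

theorem tupleSup_congr (T : X → Submodule k E) {x y : ι → X} {I : Finset ι}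
    (h : ∀ i ∈ I, x i = y i) : tupleSup T x I = tupleSup T y I :=
  biSup_congr fun i hi => by rw [h i hi]

theorem tupleSup_map {κ : Type*} (T : X → Submodule k E) (x : ι → X) (e : κ ↪ ι)
    (I : Finset κ) : tupleSup T x (I.map e) = tupleSup T (x ∘ e) I := by
  simp [tupleSup, iSup_and, iSup_comm (ι := ι)]

theorem sepOpen_finrank_tupleSup [DecidableEq ι] [TopologicalSpace X] (T : X → Submodule k E)
    (hT : ∀ (W : Submodule k E) (r : ℕ), IsOpen {x | r ≤ finrank k ↥(T x ⊔ W)})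
    (I : Finset ι) (r : ℕ) : SepOpen {x : ι → X | r ≤ finrank k (tupleSup T x I)} := by
  intro x i
  by_cases hi : i ∈ I
  · have : ∀ v, tupleSup T (Function.update x i v) I = T v ⊔ tupleSup T x (I.erase i) := fun v => by
      conv_lhs => rw [← Finset.insert_erase hi, tupleSup_insert, Function.update_self]
      rw [tupleSup_congr T (y := x) fun j hj => by simp [Finset.ne_of_mem_erase hj]]
    have hset : {v | Function.update x i v ∈ {x : ι → X | r ≤ finrank k (tupleSup T x I)}} =
        {v | r ≤ finrank k ↥(T v ⊔ tupleSup T x (I.erase i))} := by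
      ext v
      change r ≤ finrank k (tupleSup T (Function.update x i v) I) ↔ _
      rw [this]
      rfl
    rw [hset]
    exact hT _ _
  · have : ∀ v, tupleSup T (Function.update x i v) I = tupleSup T x I := fun v =>
      tupleSup_congr T fun j hj => by
        rw [Function.update_of_ne]; rintro rfl; exact hi hj
    have hset : {v | Function.update x i v ∈ {x : ι → X | r ≤ finrank k (tupleSup T x I)}} =
        {_v | r ≤ finrank k (tupleSup T x I)} := by
      ext v
      change r ≤ finrank k (tupleSup T (Function.update x i v) I) ↔ _
      rw [this]
      rfl
    rw [hset]
    exact isOpen_const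

/-- The generic dimension of a sum of `n` members of the family `T`. -/
def genRank (T : X → Submodule k E) (n : ℕ) : ℕ :=
  sSup (Set.range fun y : Fin n → X => finrank k (tupleSup T y Finset.univ))

variable [FiniteDimensional k E] (T : X → Submodule k E)

theorem bddAbove_tupleSup (n : ℕ) :
    BddAbove (Set.range fun y : Fin n → X => finrank k (tupleSup T y Finset.univ)) :=
  ⟨finrank k E, by rintro _ ⟨y, rfl⟩; exact Submodule.finrank_le _⟩

theorem exists_finrank_eq_genRank [Nonempty X] (n : ℕ) :
    ∃ y : Fin n → X, finrank k (tupleSup T y Finset.univ) = genRank T n :=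
  Nat.sSup_mem (Set.range_nonempty _) (bddAbove_tupleSup T n)

theorem finrank_tupleSup_le (x : ι → X) (I : Finset ι) :
    finrank k (tupleSup T x I) ≤ genRank T I.card := by
  conv_lhs => rw [← map_equivFin_symm_univ I, tupleSup_map]
  exact le_csSup (bddAbove_tupleSup T _) ⟨_, rfl⟩

theorem exists_finrank_tupleSup_eq [Nonempty X] (I : Finset ι) :
    ∃ x : ι → X, finrank k (tupleSup T x I) = genRank T I.card := by
  classical
  obtain ⟨y, hy⟩ := exists_finrank_eq_genRank T I.card
  let x : ι → X := fun i => if h : i ∈ I then y (I.equivFin ⟨i, h⟩) else Classical.arbitrary X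
  refine ⟨x, ?_⟩
  rw [← hy]
  conv_lhs => rw [← map_equivFin_symm_univ I, tupleSup_map]
  have : x ∘ (I.equivFin.symm.toEmbedding.trans (Function.Embedding.subtype _)) = y := by
    funext a
    simp [x]
  rw [this]

/-- Tuples all of whose partial sums have the generic dimension. -/
def genericTuples (T : X → Submodule k E) (ι : Type*) : Set (ι → X) :=
  {x | ∀ I : Finset ι, finrank k (tupleSup T x I) = genRank T I.card}

theorem genericTuples_eq_iInter (ι : Type*) [Fintype ι] : genericTuples T ι =
    ⋂ I ∈ (Finset.univ : Finset (Finset ι)),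
      {x : ι → X | genRank T I.card ≤ finrank k (tupleSup T x I)} := by
  ext x
  simp only [genericTuples, Set.mem_ofPred_eq, Finset.mem_univ, Set.iInter_true, Set.mem_iInter]
  exact forall_congr' fun I => ⟨fun h => h.ge, fun h => (finrank_tupleSup_le T x I).antisymm h⟩

variable [TopologicalSpace X]

theorem genericTuples_sepOpen_nonempty [PreirreducibleSpace X] [Nonempty X]
    (hT : ∀ (W : Submodule k E) (r : ℕ), IsOpen {x | r ≤ finrank k ↥(T x ⊔ W)})
    (ι : Type*) [Fintype ι] [DecidableEq ι] :
    SepOpen (genericTuples T ι) ∧ (genericTuples T ι).Nonempty := by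
  rw [genericTuples_eq_iInter]
  refine SepOpen.biInter _ _ (fun I _ => sepOpen_finrank_tupleSup T hT I _) fun I _ => ?_
  obtain ⟨x, hx⟩ := exists_finrank_tupleSup_eq T (X := X) I
  exact ⟨x, hx.ge⟩

end TangentSums

section Stall

variable {k E X ι : Type*} [Field k] [AddCommGroup E] [Module k E] {T : X → Submodule k E}
  {G : Type*} [Group G] {ρ : G →* (E ≃ₗ[k] E)} {φ : G → X → X}

theorem tupleSup_comp (hφ : ∀ g x, T (φ g x) = (T x).map (ρ g : E →ₗ[k] E)) (g : G)
    (x : ι → X) (I : Finset ι) :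
    tupleSup T (φ g ∘ x) I = (tupleSup T x I).map (ρ g : E →ₗ[k] E) := by
  simp [tupleSup, Submodule.map_iSup, hφ]

theorem genericTuples_comp (hφ : ∀ g x, T (φ g x) = (T x).map (ρ g : E →ₗ[k] E)) (g : G)
    {x : ι → X} (hx : x ∈ genericTuples T ι) : φ g ∘ x ∈ genericTuples T ι := by
  intro I
  rw [tupleSup_comp hφ, ← hx I]
  exact LinearEquiv.finrank_map_eq (ρ g) _

variable [FiniteDimensional k E]

theorem genRank_mono [Nonempty X] (n : ℕ) : genRank T n ≤ genRank T (n + 1) := by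
  obtain ⟨x, hx⟩ := exists_finrank_tupleSup_eq T
    ((Finset.univ : Finset (Fin n)).map Fin.castSuccEmb)
  rw [Finset.card_map, Finset.card_univ, Fintype.card_fin] at hx
  rw [← hx]
  refine (Submodule.finrank_mono (tupleSup_mono T x (Finset.subset_univ _))).trans ?_
  simpa using finrank_tupleSup_le T x Finset.univ

theorem finrank_inf_tupleSup [DecidableEq ι] {x : ι → X} (hx : x ∈ genericTuples T ι) {p : ι}
    {I : Finset ι} (hp : p ∉ I) :
    genRank T (I.card + 1) + finrank k ↥(T (x p) ⊓ tupleSup T x I) =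
      genRank T 1 + genRank T I.card := by
  have h := Submodule.finrank_sup_add_finrank_inf_eq (T (x p)) (tupleSup T x I)
  have h1 := hx (insert p I)
  have h2 := hx {p}
  have h3 : tupleSup T x {p} = T (x p) := by simp [tupleSup]
  rw [Finset.card_singleton, h3] at h2
  rw [tupleSup_insert, Finset.card_insert_of_notMem hp] at h1
  rw [← h1, ← h2, ← hx I]
  exact h

theorem inf_tupleSup_insert [DecidableEq ι] {n : ℕ}
    (hstall : genRank T n + genRank T (n + 2) = 2 * genRank T (n + 1))
    {x : ι → X} (hx : x ∈ genericTuples T ι) {p q : ι} {I : Finset ι} (hI : I.card = n)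
    (hp : p ∉ I) (hq : q ∉ I) (hpq : p ≠ q) :
    T (x p) ⊓ tupleSup T x I = T (x p) ⊓ tupleSup T x (insert q I) := by
  refine Submodule.eq_of_le_of_finrank_eq
    (inf_le_inf_left _ (tupleSup_mono T x (Finset.subset_insert _ _))) ?_
  have h1 := finrank_inf_tupleSup hx hp
  have h2 := finrank_inf_tupleSup hx (p := p) (I := insert q I) (by simp [hpq, hp])
  rw [Finset.card_insert_of_notMem hq] at h2
  rw [hI] at h1 h2
  rw [add_assoc] at h2
  norm_num at h2
  omega

theorem inf_tupleSup_eq [DecidableEq ι] {n : ℕ}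
    (hstall : genRank T n + genRank T (n + 2) = 2 * genRank T (n + 1))
    {x : ι → X} (hx : x ∈ genericTuples T ι) {p : ι} :
    ∀ {I J : Finset ι}, I.card = n → J.card = n → p ∉ I → p ∉ J →
      T (x p) ⊓ tupleSup T x I = T (x p) ⊓ tupleSup T x J := by
  intro I J
  induction hd : (I \ J).card generalizing I with
  | zero =>
    intro hI hJ _ _
    have hsub : I ⊆ J := by simpa using hd
    rw [Finset.eq_of_subset_of_card_le hsub (by omega)]
  | succ d ih =>
    intro hI hJ hpI hpJ
    obtain ⟨i, hi⟩ : (I \ J).Nonempty := Finset.card_pos.mp (by omega)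
    obtain ⟨j, hj⟩ : (J \ I).Nonempty := by
      refine Finset.card_pos.mp ?_
      have := Finset.card_sdiff_add_card_inter I J
      have := Finset.card_sdiff_add_card_inter J I
      rw [Finset.inter_comm] at this
      omega
    rw [Finset.mem_sdiff] at hi hj
    have hij : i ≠ j := by rintro rfl; exact hj.2 hi.1
    have hpi : p ≠ i := by rintro rfl; exact hpI hi.1
    have hpj : p ≠ j := by rintro rfl; exact hpJ hj.1
    set I' := insert j (I.erase i) with hI'
    have hcard : I'.card = n := by
      rw [hI', Finset.card_insert_of_notMem (by simp [hj.2]), Finset.card_erase_of_mem hi.1]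
      have := Finset.card_pos.mpr ⟨i, hi.1⟩
      omega
    have hins : insert i I' = insert j I := by
      rw [hI', Finset.insert_comm, Finset.insert_erase hi.1]
    have hsd : I' \ J = (I \ J).erase i := by
      ext a
      simp only [hI', Finset.mem_sdiff, Finset.mem_insert, Finset.mem_erase]
      constructor
      · rintro ⟨rfl | h, h'⟩
        · exact absurd hj.1 h'
        · exact ⟨h.1, h.2, h'⟩
      · rintro ⟨h1, h2, h3⟩
        exact ⟨Or.inr ⟨h1, h2⟩, h3⟩
    have hpI' : p ∉ I' := by simp [hI', hpj, hpI]
    rw [inf_tupleSup_insert hstall hx hI hpI hj.2 hpj, ← hins,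
      ← inf_tupleSup_insert hstall hx hcard hpI' (by simp [hI', hij]) hpi]
    refine ih ?_ hcard hJ hpI' hpJ
    rw [hsd, Finset.card_erase_of_mem (by simp [hi])]
    omega

/-- A finite subfamily already realises the infimum of a family of subspaces. -/
theorem exists_finset_iInf_eq {α : Type*} (Y : Set α) (W : α → Submodule k E) :
    ∃ s : Finset α, ↑s ⊆ Y ∧ ⨅ y ∈ s, W y = ⨅ y ∈ Y, W y := by
  classical
  obtain ⟨s, hs, hmin⟩ := exists_minimalFor_of_wellFoundedLT
    (fun s : Finset α => (s : Set α) ⊆ Y)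
    (fun s : Finset α => finrank k ↥(⨅ y ∈ s, W y)) ⟨∅, by simp⟩
  refine ⟨s, hs, le_antisymm (le_iInf₂ fun y hy => ?_) (le_iInf₂ fun y hy => iInf₂_le y (hs hy))⟩
  have hle : ⨅ z ∈ insert y s, W z ≤ ⨅ z ∈ s, W z := by
    rw [Finset.iInf_insert]; exact inf_le_right
  have heq := Submodule.eq_of_le_of_finrank_le hle
    (hmin (by simp [Set.insert_subset_iff, hy, hs]) (Submodule.finrank_mono hle))
  rw [← heq, Finset.iInf_insert]
  exact inf_le_left

variable [TopologicalSpace X] [PreirreducibleSpace X] [Nonempty X]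

theorem genRank_eq_finrank_of_stall
    (hT : ∀ (W : Submodule k E) (r : ℕ), IsOpen {x | r ≤ finrank k ↥(T x ⊔ W)})
    (hφ : ∀ g x, T (φ g x) = (T x).map (ρ g : E →ₗ[k] E))
    (hρ : ∀ W : Submodule k E, (∀ g : G, ∀ x ∈ W, ρ g x ∈ W) → W = ⊥ ∨ W = ⊤) {n : ℕ}
    (hstall : genRank T n + genRank T (n + 2) = 2 * genRank T (n + 1))
    (hlt : genRank T (n + 1) < genRank T n + genRank T 1) :
    genRank T n = finrank k E := by
  classical
  let κ := Option (Fin n)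
  let Y : Set (Fin n → X) := {y | ∃ z : κ → X, Sum.elim y z ∈ genericTuples T (Fin n ⊕ κ)}
  have hYG : ∀ g, ∀ y ∈ Y, φ g ∘ y ∈ Y := by
    rintro g y ⟨z, hz⟩
    refine ⟨φ g ∘ z, ?_⟩
    have := genericTuples_comp hφ g hz
    rwa [Sum.comp_elim] at this
  obtain ⟨hopen, ⟨x₀, hx₀⟩⟩ := genericTuples_sepOpen_nonempty T hT (Fin n ⊕ κ)
  have hy₀ : x₀ ∘ Sum.inl ∈ Y := ⟨x₀ ∘ Sum.inr, by rwa [Sum.elim_comp_inl_inr]⟩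
  set y₀ := x₀ ∘ Sum.inl
  let left : Finset (Fin n ⊕ κ) := Finset.univ.map Function.Embedding.inl
  let right : Finset (Fin n ⊕ κ) :=
    (Finset.univ.map (Function.Embedding.some : Fin n ↪ κ)).map Function.Embedding.inr
  have hnone : (Sum.inr none : Fin n ⊕ κ) ∉ right := by
    simp only [right, Finset.mem_map, Finset.mem_univ, true_and, Function.Embedding.inr_apply]
    rintro ⟨_, ⟨a, rfl⟩, h⟩
    cases h
  have hleft : ∀ (y : Fin n → X) (z : κ → X),
      tupleSup T (Sum.elim y z) left = tupleSup T y Finset.univ := fun y z => by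
    simp only [left]
    rw [tupleSup_map]
    rfl
  have hright : ∀ (y : Fin n → X) (z : κ → X),
      tupleSup T (Sum.elim y z) right = tupleSup T (z ∘ some) Finset.univ := fun y z => by
    simp only [right]
    rw [tupleSup_map, tupleSup_map]
    rfl
  let L : Submodule k E := ⨅ y ∈ Y, tupleSup T y Finset.univ
  have hL : ∀ g : G, ∀ v ∈ L, ρ g v ∈ L := by
    intro g v hv
    simp only [L, Submodule.mem_iInf] at hv ⊢
    intro y hy
    have h1 := hv _ (hYG g⁻¹ y hy)
    rw [tupleSup_comp hφ] at h1
    obtain ⟨w, hw, rfl⟩ := h1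
    have : ρ g (ρ g⁻¹ w) = w := by
      rw [← LinearEquiv.mul_apply, ← map_mul]; simp
    simpa [this] using hw
  rcases hρ L hL with hbot | htop
  · exfalso
    obtain ⟨s, hsY, hs⟩ := exists_finset_iInf_eq Y fun y => tupleSup T y Finset.univ
    obtain ⟨-, z, hz⟩ := SepOpen.biInter (insert y₀ s)
      (fun y => {z : κ → X | Sum.elim y z ∈ genericTuples T (Fin n ⊕ κ)})
      (fun y _ z i => by
        have := hopen (Sum.elim y z) (Sum.inr i)
        simp only [Sum.update_elim_inr] at this
        exact this)
      (fun y hy => by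
        rcases Finset.mem_insert.mp hy with rfl | hy
        · exact hy₀
        · exact hsY hy)
    simp only [Set.mem_iInter] at hz
    have heq : ∀ y ∈ insert y₀ s, T (z none) ⊓ tupleSup T (z ∘ some) Finset.univ =
        T (z none) ⊓ tupleSup T y Finset.univ := fun y hy => by
      have := inf_tupleSup_eq hstall (hz y hy) (p := Sum.inr none) (I := right) (J := left)
        (by simp [right]) (by simp [left]) hnone (by simp [left])
      rwa [hleft, hright] at this
    have hz0 := hz y₀ (by simp)
    have hfin := finrank_inf_tupleSup hz0 (p := Sum.inr none) (I := right) hnone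
    have hle : T (z none) ⊓ tupleSup T (z ∘ some) Finset.univ ≤ ⊥ := by
      rw [← hbot, show L = _ from hs.symm]
      refine le_iInf₂ fun y hy => ?_
      rw [heq y (Finset.mem_insert_of_mem hy)]
      exact inf_le_right
    rw [hright] at hfin
    have hc : right.card = n := by simp [right]
    rw [hc] at hfin
    have h0 : finrank k ↥(T (z none) ⊓ tupleSup T (z ∘ some) Finset.univ) = 0 := by
      rw [le_bot_iff.mp hle]; simp
    have : genRank T (n + 1) + 0 = genRank T 1 + genRank T n := by rw [← h0]; exact hfin
    omega
  · have hW : tupleSup T y₀ Finset.univ = ⊤ :=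
      top_le_iff.mp (htop ▸ iInf₂_le y₀ hy₀)
    have h1 := finrank_tupleSup_le T y₀ Finset.univ
    rw [hW, finrank_top, Finset.card_univ, Fintype.card_fin] at h1
    refine le_antisymm ?_ h1
    obtain ⟨y, hy⟩ := exists_finrank_eq_genRank T n
    rw [← hy]
    exact Submodule.finrank_le _

theorem genRank_add_genRank_le
    (hT : ∀ (W : Submodule k E) (r : ℕ), IsOpen {x | r ≤ finrank k ↥(T x ⊔ W)}) (n : ℕ) :
    genRank T n + genRank T (n + 2) ≤ 2 * genRank T (n + 1) := by
  classical
  obtain ⟨-, x, hx⟩ := genericTuples_sepOpen_nonempty T hT (Option (Option (Fin n)))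
  let I : Finset (Option (Option (Fin n))) := Finset.univ.map
    (Function.Embedding.some.trans Function.Embedding.some)
  have hI : I.card = n := by simp [I]
  have hp : none ∉ I := by simp [I]
  have hq : some none ∉ I := by simp [I]
  have h1 := finrank_inf_tupleSup hx hp
  have h2 := finrank_inf_tupleSup hx (p := none) (I := insert (some none) I) (by simp [hp])
  rw [Finset.card_insert_of_notMem hq] at h2
  have h3 := Submodule.finrank_mono (inf_le_inf_left (T (x none))
    (tupleSup_mono T x (Finset.subset_insert (some none) I)))
  rw [hI] at h1 h2
  rw [add_assoc] at h2
  norm_num at h2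
  omega

/-- If the family spans generically `N`-dimensional subspaces of an irreducible representation,
then sums of few generic members are direct. -/
theorem genRank_eq_mul
    (hT : ∀ (W : Submodule k E) (r : ℕ), IsOpen {x | r ≤ finrank k ↥(T x ⊔ W)})
    (hφ : ∀ g x, T (φ g x) = (T x).map (ρ g : E →ₗ[k] E))
    (hρ : ∀ W : Submodule k E, (∀ g : G, ∀ x ∈ W, ρ g x ∈ W) → W = ⊥ ∨ W = ⊤) {m N : ℕ}
    (hN : genRank T 1 = N) (hm : 1 ≤ m) (hbound : N * (m + N) ≤ finrank k E) :
    genRank T m = m * N := by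
  have h0 : genRank T 0 = 0 := by
    obtain ⟨y, hy⟩ := exists_finrank_eq_genRank T 0
    rw [← hy, Finset.univ_eq_empty, show tupleSup T y ∅ = ⊥ by simp [tupleSup], finrank_bot]
  have hconc : ∀ n, genRank T n + genRank T (n + 1 + 1) ≤ 2 * genRank T (n + 1) :=
    genRank_add_genRank_le hT
  have hmono := genRank_mono (T := T)
  have hstep : ∀ n, genRank T (n + 1) ≤ genRank T n + N := by
    intro n
    induction n with
    | zero => simp [h0, hN]
    | succ n ih => have := hconc n; omega
  have hle : ∀ n, genRank T n ≤ n * N := by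
    intro n
    induction n with
    | zero => simp [h0]
    | succ n ih => have := hstep n; rw [add_mul]; omega
  by_contra hne
  have hlt : genRank T m < m * N := lt_of_le_of_ne (hle m) hne
  obtain ⟨l, rfl⟩ : ∃ l, m = l + 1 := ⟨m - 1, by omega⟩
  have hsmall : ∀ i ≤ N, genRank T (l + i) < finrank k E := by
    intro i hi
    refine (hle _).trans_lt (lt_of_lt_of_le ?_ hbound)
    have hNpos : 0 < N := by
      rcases Nat.eq_zero_or_pos N with h | h
      · simp [h] at hlt
      · exact h
    nlinarith
  have hfirst : genRank T (l + 1) < genRank T l + N := by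
    by_contra hge
    have hall : ∀ n ≤ l, genRank T n + N ≤ genRank T (n + 1) := by
      intro n hn
      induction hn using Nat.decreasingInduction with
      | self => omega
      | of_succ n hn ih => have := hconc n; omega
    have : ∀ n ≤ l + 1, n * N ≤ genRank T n := by
      intro n
      induction n with
      | zero => simp
      | succ n ih => intro hn; have := hall n (by omega); have := ih (by omega); rw [add_mul]; omega
    have := this (l + 1) le_rfl
    omega
  have hdec : ∀ i ≤ N, genRank T (l + i + 1) + i + 1 ≤ genRank T (l + i) + N := by
    intro i
    induction i with
    | zero => intro _; simpa using hfirst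
    | succ i ih =>
      intro hi
      have h1 := ih (by omega)
      have h2 := hconc (l + i)
      have h3 : genRank T (l + i) + genRank T (l + i + 1 + 1) ≠ 2 * genRank T (l + i + 1) := by
        intro hst
        have := genRank_eq_finrank_of_stall hT hφ hρ hst (by omega)
        have := hsmall i (by omega)
        omega
      have : l + (i + 1) + 1 = l + i + 1 + 1 := by ring
      rw [this, ← add_assoc l i 1]
      omega
  have := hdec N le_rfl
  have := hmono (l + N)
  omega

end Stall

open MvPolynomial in
theorem mem_vanishingIdeal_iff_eval {ι : Type*} {S : Set (ι → ℂ)} {f : MvPolynomial ι ℂ} :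
    f ∈ vanishingIdeal ℂ S ↔ ∀ x ∈ S, eval x f = 0 := by
  simp [mem_vanishingIdeal_iff, MvPolynomial.aeval_eq_eval]

theorem zt_isTopologicalBasis (ι : Type*) :
    @TopologicalSpace.IsTopologicalBasis _ (zt ι)
      {U | ∃ f : MvPolynomial ι ℂ, U = {x | MvPolynomial.eval x f ≠ 0}} := by
  let _ := zt ι
  refine ⟨?_, ?_, rfl⟩
  · rintro _ ⟨f, rfl⟩ _ ⟨g, rfl⟩ x ⟨hf, hg⟩
    refine ⟨_, ⟨f * g, rfl⟩, ?_, ?_⟩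
    · simpa using ⟨hf, hg⟩
    · intro y hy
      simpa using hy
  · refine Set.eq_univ_of_forall fun x => ⟨_, ⟨1, rfl⟩, by simp⟩

/-- A set is Zariski closed iff every point at which all polynomials vanishing on it vanish
belongs to it. -/
theorem mem_zClosure_iff {ι : Type*} {S : Set (ι → ℂ)} {x : ι → ℂ} :
    x ∈ zClosure S ↔ ∀ f ∈ MvPolynomial.vanishingIdeal ℂ S, MvPolynomial.eval x f = 0 := by
  let _ := zt ι
  unfold zClosure
  rw [(zt_isTopologicalBasis ι).mem_closure_iff]
  constructor
  · intro h f hf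
    by_contra hx
    obtain ⟨y, hy, hyS⟩ := h _ ⟨f, rfl⟩ hx
    exact hy (mem_vanishingIdeal_iff_eval.1 hf y hyS)
  · rintro h _ ⟨f, rfl⟩ hx
    by_contra hne
    refine hx (h f (mem_vanishingIdeal_iff_eval.2 fun y hy => ?_))
    by_contra hy'
    exact hne ⟨y, hy', hy⟩

theorem zIsClosed_iff {ι : Type*} {S : Set (ι → ℂ)} :
    zIsClosed S ↔
      ∀ x, (∀ f ∈ MvPolynomial.vanishingIdeal ℂ S, MvPolynomial.eval x f = 0) → x ∈ S := by
  let _ := zt ι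
  constructor
  · intro h x hx
    have : x ∈ zClosure S := mem_zClosure_iff.2 hx
    rwa [zClosure, IsClosed.closure_eq h] at this
  · intro h
    refine isClosed_of_closure_subset fun x hx => h x (mem_zClosure_iff.1 hx)

theorem vanishingIdeal_zClosure {ι : Type*} (S : Set (ι → ℂ)) :
    MvPolynomial.vanishingIdeal ℂ (zClosure S) = MvPolynomial.vanishingIdeal ℂ S := by
  let _ := zt ι
  refine le_antisymm (MvPolynomial.vanishingIdeal_anti_mono subset_closure) fun f hf => ?_
  exact mem_vanishingIdeal_iff_eval.2 fun x hx => mem_zClosure_iff.1 hx f hf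

theorem isOpen_eval_ne_zero {ι : Type*} (f : MvPolynomial ι ℂ) :
    @IsOpen _ (zt ι) {x | MvPolynomial.eval x f ≠ 0} :=
  TopologicalSpace.isOpen_generateFrom_of_mem ⟨f, rfl⟩

theorem zIsIrreducible_iff {ι : Type*} {S : Set (ι → ℂ)} :
    zIsIrreducible S ↔ (MvPolynomial.vanishingIdeal ℂ S).IsPrime := by
  let _ := zt ι
  have hne : ∀ f : MvPolynomial ι ℂ, f ∉ MvPolynomial.vanishingIdeal ℂ S ↔
      (S ∩ {x | MvPolynomial.eval x f ≠ 0}).Nonempty := by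
    intro f
    rw [mem_vanishingIdeal_iff_eval]
    push Not
    rfl
  constructor
  · intro h
    refine ⟨fun htop => ?_, fun {f g} hfg => ?_⟩
    · obtain ⟨x, hx⟩ := h.1
      have := mem_vanishingIdeal_iff_eval.1 (htop ▸ Submodule.mem_top (x := 1)) x hx
      simp at this
    · by_contra! hcon
      obtain ⟨hf, hg⟩ := hcon
      obtain ⟨x, hxS, hxf, hxg⟩ := h.2 _ _ (isOpen_eval_ne_zero f) (isOpen_eval_ne_zero g)
        ((hne f).1 hf) ((hne g).1 hg)
      have := mem_vanishingIdeal_iff_eval.1 hfg x hxS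
      rw [map_mul] at this
      exact (mul_ne_zero hxf hxg) this
  · intro h
    refine ⟨?_, ?_⟩
    · by_contra he
      rw [Set.not_nonempty_iff_eq_empty.1 he, MvPolynomial.vanishingIdeal_empty] at h
      exact h.ne_top rfl
    · rintro u v hu hv ⟨x, hxS, hxu⟩ ⟨y, hyS, hyv⟩
      obtain ⟨_, ⟨f, rfl⟩, hxf, hfu⟩ :=
        (zt_isTopologicalBasis ι).exists_subset_of_mem_open hxu hu
      obtain ⟨_, ⟨g, rfl⟩, hyg, hgv⟩ :=
        (zt_isTopologicalBasis ι).exists_subset_of_mem_open hyv hv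
      have hfg : f * g ∉ MvPolynomial.vanishingIdeal ℂ S := fun hmem =>
        (h.mem_or_mem hmem).elim ((hne f).2 ⟨x, hxS, hxf⟩) ((hne g).2 ⟨y, hyS, hyg⟩)
      obtain ⟨z, hzS, hz⟩ := (hne _).1 hfg
      have hz' : MvPolynomial.eval z f * MvPolynomial.eval z g ≠ 0 := by simpa using hz
      exact ⟨z, hzS, hfu (left_ne_zero_of_mul hz'), hgv (right_ne_zero_of_mul hz')⟩

theorem vanishingIdeal_zeroLocus_of_isPrime {ι : Type*} [Finite ι]
    (P : Ideal (MvPolynomial ι ℂ)) [P.IsPrime] :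
    MvPolynomial.vanishingIdeal ℂ (MvPolynomial.zeroLocus ℂ P) = P :=
  MvPolynomial.IsPrime.vanishingIdeal_zeroLocus P

theorem zIsClosed_zeroLocus {ι : Type*} (P : Ideal (MvPolynomial ι ℂ)) :
    zIsClosed (MvPolynomial.zeroLocus ℂ P) := by
  refine zIsClosed_iff.2 fun x hx p hp => ?_
  rw [MvPolynomial.aeval_eq_eval]
  exact hx p (MvPolynomial.le_vanishingIdeal_zeroLocus P hp)

theorem zeroLocus_vanishingIdeal_of_zIsClosed {ι : Type*} {S : Set (ι → ℂ)} (hS : zIsClosed S) :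
    MvPolynomial.zeroLocus ℂ (MvPolynomial.vanishingIdeal ℂ S) = S := by
  refine Set.Subset.antisymm (fun x hx => zIsClosed_iff.1 hS x fun f hf => ?_)
    (MvPolynomial.zeroLocus_vanishingIdeal_le S)
  have := hx f hf
  rwa [MvPolynomial.aeval_eq_eval] at this

theorem isIrreducible_of_isIrreducible_image {X Y : Type*} [TopologicalSpace X]
    [TopologicalSpace Y] {f : X → Y} (hf : Topology.IsInducing f) {s : Set X}
    (h : IsIrreducible (f '' s)) : IsIrreducible s := by
  refine ⟨h.1.of_image, ?_⟩
  rintro u v hu hv ⟨x, hxs, hxu⟩ ⟨y, hys, hyv⟩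
  obtain ⟨u', hu', rfl⟩ := hf.isOpen_iff.1 hu
  obtain ⟨v', hv', rfl⟩ := hf.isOpen_iff.1 hv
  obtain ⟨_, ⟨z, hzs, rfl⟩, hzu, hzv⟩ :=
    h.2 u' v' hu' hv' ⟨f x, ⟨x, hxs, rfl⟩, hxu⟩ ⟨f y, ⟨y, hys, rfl⟩, hyv⟩
  exact ⟨z, hzs, hzu, hzv⟩

/-- The dimension of a Zariski closed set is the Krull dimension of its coordinate ring. -/
theorem zDim_eq_ringKrullDim {ι : Type*} [Finite ι] {S : Set (ι → ℂ)} (hS : zIsClosed S) :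
    zDim S = ringKrullDim (MvPolynomial ι ℂ ⧸ MvPolynomial.vanishingIdeal ℂ S) := by
  let _ := zt ι
  have hS' : IsClosed S := hS
  have hemb : Topology.IsClosedEmbedding (Subtype.val : S → ι → ℂ) :=
    hS'.isClosedEmbedding_subtypeVal
  rw [ringKrullDim_quotient, ← Order.krullDim_orderDual]
  change Order.krullDim (TopologicalSpace.IrreducibleCloseds S) = _
  refine le_antisymm ?_ ?_
  · have hp : ∀ Z : TopologicalSpace.IrreducibleCloseds S,
        (MvPolynomial.vanishingIdeal ℂ ((Subtype.val : S → ι → ℂ) '' Z)).IsPrime := fun Z =>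
      zIsIrreducible_iff.1 (Z.isIrreducible.image _ hemb.continuous.continuousOn)
    refine Order.krullDim_le_of_strictMono (fun Z => OrderDual.toDual
      ⟨⟨MvPolynomial.vanishingIdeal ℂ ((Subtype.val : S → ι → ℂ) '' Z), hp Z⟩,
        MvPolynomial.vanishingIdeal_anti_mono (by rintro _ ⟨x, -, rfl⟩; exact x.2)⟩) ?_
    have hle : ∀ Z₁ Z₂ : TopologicalSpace.IrreducibleCloseds S,
        MvPolynomial.vanishingIdeal ℂ ((Subtype.val : S → ι → ℂ) '' Z₂) ≤
          MvPolynomial.vanishingIdeal ℂ ((Subtype.val : S → ι → ℂ) '' Z₁) ↔ Z₁ ≤ Z₂ := by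
      intro Z₁ Z₂
      constructor
      · intro h
        have h2 := MvPolynomial.zeroLocus_anti_mono (K := ℂ) h
        rw [zeroLocus_vanishingIdeal_of_zIsClosed (hemb.isClosedMap _ Z₁.isClosed),
          zeroLocus_vanishingIdeal_of_zIsClosed (hemb.isClosedMap _ Z₂.isClosed)] at h2
        exact (Set.image_subset_image_iff Subtype.val_injective).1 h2
      · intro h
        exact MvPolynomial.vanishingIdeal_anti_mono (Set.image_mono h)
    intro Z₁ Z₂ h
    rw [lt_iff_le_not_ge] at h ⊢
    exact ⟨(hle _ _).2 h.1, fun h' => h.2 ((hle _ _).1 h')⟩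
  · have hsub : ∀ p : PrimeSpectrum.zeroLocus
        (MvPolynomial.vanishingIdeal ℂ S : Set (MvPolynomial ι ℂ)),
        MvPolynomial.zeroLocus ℂ p.1.asIdeal ⊆ S := fun p => by
      have := MvPolynomial.zeroLocus_anti_mono (K := ℂ)
        (show MvPolynomial.vanishingIdeal ℂ S ≤ p.1.asIdeal from p.2)
      rwa [zeroLocus_vanishingIdeal_of_zIsClosed hS] at this
    have him : ∀ p : PrimeSpectrum.zeroLocus
        (MvPolynomial.vanishingIdeal ℂ S : Set (MvPolynomial ι ℂ)),
        (Subtype.val : S → ι → ℂ) '' (Subtype.val ⁻¹' MvPolynomial.zeroLocus ℂ p.1.asIdeal) =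
          MvPolynomial.zeroLocus ℂ p.1.asIdeal := fun p => by
      rw [Subtype.image_preimage_coe, Set.inter_eq_right.2 (hsub p)]
    refine Order.krullDim_le_of_strictMono (fun p =>
      (⟨Subtype.val ⁻¹' MvPolynomial.zeroLocus ℂ (OrderDual.ofDual p).1.asIdeal, ?_,
        (zIsClosed_zeroLocus _).preimage hemb.continuous⟩ :
          TopologicalSpace.IrreducibleCloseds S)) ?_
    · have := (OrderDual.ofDual p).1.isPrime
      refine isIrreducible_of_isIrreducible_image hemb.isInducing ?_
      rw [him]
      refine zIsIrreducible_iff.2 ?_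
      rwa [vanishingIdeal_zeroLocus_of_isPrime]
    · have hle : ∀ p q : PrimeSpectrum.zeroLocus
          (MvPolynomial.vanishingIdeal ℂ S : Set (MvPolynomial ι ℂ)),
          (Subtype.val ⁻¹' MvPolynomial.zeroLocus ℂ p.1.asIdeal : Set S) ⊆
            Subtype.val ⁻¹' MvPolynomial.zeroLocus ℂ q.1.asIdeal ↔ q ≤ p := by
        intro p q
        constructor
        · intro h
          have h2 := Set.image_mono (f := (Subtype.val : S → ι → ℂ)) h
          rw [him, him] at h2
          have h3 := MvPolynomial.vanishingIdeal_anti_mono (k := ℂ) h2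
          have := p.1.isPrime
          have := q.1.isPrime
          rwa [vanishingIdeal_zeroLocus_of_isPrime, vanishingIdeal_zeroLocus_of_isPrime] at h3
        · intro h
          exact Set.preimage_mono (MvPolynomial.zeroLocus_anti_mono h)
      intro p q h
      rw [lt_iff_le_not_ge] at h ⊢
      exact ⟨(hle _ _).2 h.1, fun h' => h.2 ((hle _ _).1 h')⟩

/-- Integral extensions of domains preserve the Krull dimension. -/
theorem ringKrullDim_eq_of_isIntegral {A B : Type*} [CommRing A] [CommRing B] [IsDomain A]
    [IsDomain B] [Algebra A B] [FaithfulSMul A B] [Algebra.IsIntegral A B] :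
    ringKrullDim B = ringKrullDim A := by
  refine le_antisymm (Order.krullDim_le_of_strictMono (PrimeSpectrum.comap (algebraMap A B)) ?_) ?_
  · intro p q h
    have := p.isPrime
    exact Ideal.IsIntegral.comap_lt_comap h
  · refine iSup_le fun l => ?_
    obtain ⟨P, hP, hl⟩ : ∃ P : Ideal B, P.IsPrime ∧ P.LiesOver l.head.asIdeal := by
      obtain ⟨Q, hQ, hc⟩ := Ideal.exists_ideal_over_prime_of_isIntegral_of_isDomain
        (S := B) l.head.asIdeal (by
          rw [(RingHom.injective_iff_ker_eq_bot _).1 (FaithfulSMul.algebraMap_injective A B)]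
          exact bot_le)
      exact ⟨Q, hQ, ⟨hc.symm⟩⟩
    obtain ⟨L, hL, -⟩ := Ideal.exists_ltSeries_of_hasGoingUp (S := B) l P
    rw [← hL]
    exact le_iSup (fun L : LTSeries (PrimeSpectrum B) => ((L.length : ℕ∞) : WithBot ℕ∞)) L

/-- A finitely generated domain over a field is an integral extension of a polynomial ring in
as many variables as its Krull dimension. -/
theorem exists_integral_injective_ringKrullDim_eq (k A : Type*) [Field k] [CommRing A]
    [IsDomain A] [Algebra k A] [Algebra.FiniteType k A] :
    ∃ s : ℕ, ∃ g : MvPolynomial (Fin s) k →ₐ[k] A,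
      Function.Injective g ∧ g.IsIntegral ∧ ringKrullDim A = s := by
  obtain ⟨s, g, hg, hint⟩ := exists_integral_inj_algHom_of_fg k A
  refine ⟨s, g, hg, hint, ?_⟩
  let _ : Algebra (MvPolynomial (Fin s) k) A := g.toRingHom.toAlgebra
  have : FaithfulSMul (MvPolynomial (Fin s) k) A := (faithfulSMul_iff_algebraMap_injective _ _).2 hg
  have : Algebra.IsIntegral (MvPolynomial (Fin s) k) A := ⟨hint⟩
  rw [ringKrullDim_eq_of_isIntegral (A := MvPolynomial (Fin s) k),
    MvPolynomial.ringKrullDim_of_isNoetherianRing, ringKrullDim_eq_zero_of_field]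
  simp

/-- The directions `v` along which all elements of `P` have vanishing derivative at the `F`-valued
point `φ`. -/
def tangentSpace {ι k F : Type*} [Fintype ι] [Field k] [Field F]
    (φ : MvPolynomial ι k →+* F) (P : Ideal (MvPolynomial ι k)) : Submodule F (ι → F) where
  carrier := {v | ∀ f ∈ P, ∑ j, v j * φ (MvPolynomial.pderiv j f) = 0}
  add_mem' {v w} hv hw f hf := by
    simp only [Pi.add_apply, add_mul, Finset.sum_add_distrib, hv f hf, hw f hf, add_zero]
  zero_mem' f _ := by simp
  smul_mem' c v hv f hf := by
    simp only [Pi.smul_apply, smul_eq_mul, mul_assoc, ← Finset.mul_sum, hv f hf, mul_zero]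

theorem mem_tangentSpace {ι k F : Type*} [Fintype ι] [Field k] [Field F]
    {φ : MvPolynomial ι k →+* F} {P : Ideal (MvPolynomial ι k)} {v : ι → F} :
    v ∈ tangentSpace φ P ↔ ∀ f ∈ P, ∑ j, v j * φ (MvPolynomial.pderiv j f) = 0 :=
  Iff.rfl

/-- A map satisfying the Leibniz rule is determined by its values on the variables. -/
theorem MvPolynomial.eq_sum_pderiv_of_leibniz {ι k S : Type*} [Fintype ι] [CommRing k]
    [CommRing S] (φ : MvPolynomial ι k →+* S) (d : MvPolynomial ι k → S)
    (hC : ∀ a, d (C a) = 0) (hadd : ∀ f g, d (f + g) = d f + d g)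
    (hmul : ∀ f g, d (f * g) = φ f * d g + φ g * d f) (f : MvPolynomial ι k) :
    d f = ∑ j, d (X j) * φ (pderiv j f) := by
  classical
  induction f using MvPolynomial.induction_on with
  | C a => simp [hC]
  | add p q hp hq => simp [hadd, hp, hq, mul_add, Finset.sum_add_distrib]
  | mul_X p i hp =>
    simp only [Derivation.leibniz, hmul, hp, pderiv_X, smul_eq_mul, map_add, map_mul,
      mul_add, Finset.sum_add_distrib, Finset.mul_sum]
    congr 1
    · rw [Finset.sum_eq_single i]
      · simp [mul_comm]
      · intro j _ hj
        simp [Pi.single_eq_of_ne hj.symm]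
      · simp
    · exact Finset.sum_congr rfl fun j _ => by ring

theorem MvPolynomial.sum_pderiv_leibniz {ι k S : Type*} [Fintype ι] [CommRing k]
    [CommRing S] (φ : MvPolynomial ι k →+* S) (v : ι → S) (f g : MvPolynomial ι k) :
    ∑ j, v j * φ (pderiv j (f * g)) =
      φ f * ∑ j, v j * φ (pderiv j g) + φ g * ∑ j, v j * φ (pderiv j f) := by
  rw [Finset.mul_sum, Finset.mul_sum, ← Finset.sum_add_distrib]
  refine Finset.sum_congr rfl fun j _ => ?_
  simp only [Derivation.leibniz, smul_eq_mul, map_add, map_mul]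
  ring

theorem finrank_kaehlerDifferential_of_formallyEtale (k K : Type*) (s : ℕ) [Field k] [Field K]
    [Algebra k K] [Algebra (MvPolynomial (Fin s) k) K]
    [IsScalarTower k (MvPolynomial (Fin s) k) K]
    [Algebra.FormallyEtale (MvPolynomial (Fin s) k) K] :
    finrank K (Ω[K⁄k]) = s := by
  rw [finrank_eq_card_basis
    (((KaehlerDifferential.mvPolynomialBasis k (Fin s)).baseChange K).map
      (KaehlerDifferential.tensorKaehlerEquivOfFormallyEtale k (MvPolynomial (Fin s) k) K)),
    Fintype.card_fin]

theorem formallyEtale_of_isAlgebraic (B K : Type*) [CommRing B] [IsDomain B] [Field K] [CharZero K]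
    [Algebra B K] [FaithfulSMul B K] [Algebra.IsAlgebraic B K] : Algebra.FormallyEtale B K := by
  let _ : Algebra (FractionRing B) K := FractionRing.liftAlgebra B K
  have : CharZero (FractionRing B) :=
    ⟨fun a b h => Nat.cast_injective (R := K) (by
      simpa using congrArg (algebraMap (FractionRing B) K) h)⟩
  have : Algebra.IsAlgebraic (FractionRing B) K :=
    ⟨fun x => (Algebra.IsAlgebraic.isAlgebraic (R := B) x).extendScalars
      (IsFractionRing.injective B (FractionRing B))⟩
  have : Algebra.FormallyEtale B (FractionRing B) :=
    Algebra.FormallyEtale.of_isLocalization (nonZeroDivisors B)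
  have : Algebra.FormallyEtale (FractionRing B) K := Algebra.FormallyEtale.of_isSeparable _ _
  exact Algebra.FormallyEtale.comp B (FractionRing B) K

theorem finrank_tensor_kaehlerDifferential {k A K : Type*} [Field k] [CharZero k] [CommRing A]
    [IsDomain A] [Algebra k A] [Field K] [Algebra A K] [IsFractionRing A K]
    [Algebra k K] [IsScalarTower k A K] {s : ℕ}
    (g : MvPolynomial (Fin s) k →ₐ[k] A) (hg : Function.Injective g) (hint : g.IsIntegral) :
    finrank K (K ⊗[A] Ω[A⁄k]) = s := by
  let _ : Algebra (MvPolynomial (Fin s) k) A := g.toRingHom.toAlgebra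
  let _ : Algebra (MvPolynomial (Fin s) k) K := ((algebraMap A K).comp g.toRingHom).toAlgebra
  have : IsScalarTower (MvPolynomial (Fin s) k) A K := IsScalarTower.of_algebraMap_eq' rfl
  have : IsScalarTower k (MvPolynomial (Fin s) k) K := by
    refine IsScalarTower.of_algebraMap_eq' ?_
    rw [IsScalarTower.algebraMap_eq k A K]
    change _ = ((algebraMap A K).comp g.toRingHom).comp _
    rw [RingHom.comp_assoc]
    congr 1
    exact g.comp_algebraMap.symm
  have : Algebra.IsIntegral (MvPolynomial (Fin s) k) A := ⟨hint⟩
  have : FaithfulSMul (MvPolynomial (Fin s) k) K := by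
    refine (faithfulSMul_iff_algebraMap_injective _ _).2 ?_
    exact (IsFractionRing.injective A K).comp hg
  have : Algebra.IsAlgebraic A K := IsLocalization.isAlgebraic K (nonZeroDivisors A)
  have : Algebra.IsAlgebraic (MvPolynomial (Fin s) k) K :=
    Algebra.IsAlgebraic.trans (MvPolynomial (Fin s) k) A K
  have : CharZero K := charZero_of_injective_algebraMap (algebraMap k K).injective
  have := formallyEtale_of_isAlgebraic (MvPolynomial (Fin s) k) K
  have : Algebra.FormallyEtale A K :=
    Algebra.FormallyEtale.of_isLocalization (nonZeroDivisors A)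
  rw [(KaehlerDifferential.tensorKaehlerEquivOfFormallyEtale k A K).finrank_eq,
    finrank_kaehlerDifferential_of_formallyEtale k K s]

/-- The generic tangent space of an affine variety has the dimension of the variety. -/
theorem finrank_tangentSpace_generic {ι k A K : Type*} [Fintype ι] [Field k] [CharZero k]
    [CommRing A] [IsDomain A] [Algebra k A] [Field K] [Algebra A K] [IsFractionRing A K]
    [Algebra k K] [IsScalarTower k A K] (π : MvPolynomial ι k →ₐ[k] A)
    (hπ : Function.Surjective π) {s : ℕ}
    (g : MvPolynomial (Fin s) k →ₐ[k] A) (hg : Function.Injective g) (hint : g.IsIntegral) :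
    finrank K (tangentSpace ((algebraMap A K).comp π.toRingHom) (RingHom.ker π)) = s := by
  let Φ : (K ⊗[A] Ω[A⁄k] →ₗ[K] K) →ₗ[K] (ι → K) :=
    LinearMap.pi fun j => LinearMap.applyₗ
      ((1 : K) ⊗ₜ[A] KaehlerDifferential.D k A (π (MvPolynomial.X j)))
  have hΦ : ∀ ℓ j, Φ ℓ j =
      ℓ ((1 : K) ⊗ₜ[A] KaehlerDifferential.D k A (π (MvPolynomial.X j))) :=
    fun _ _ => rfl
  have hd : ∀ ℓ f, ℓ ((1 : K) ⊗ₜ[A] KaehlerDifferential.D k A (π f)) =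
      ∑ j, Φ ℓ j * ((algebraMap A K).comp π.toRingHom) (MvPolynomial.pderiv j f) := by
    intro ℓ f
    refine MvPolynomial.eq_sum_pderiv_of_leibniz ((algebraMap A K).comp π.toRingHom)
      (fun f => ℓ ((1 : K) ⊗ₜ[A] KaehlerDifferential.D k A (π f))) ?_ ?_ ?_ f
    · intro a
      have : π (MvPolynomial.C a) = algebraMap k A a := π.commutes a
      simp [this]
    · intro f g
      simp [TensorProduct.tmul_add]
    · intro f g
      simp [TensorProduct.tmul_add, Algebra.smul_def]
  have hinj : Function.Injective Φ := by
    refine (injective_iff_map_eq_zero Φ).2 fun ℓ hℓ => ?_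
    have hz : ∀ a : A, ℓ ((1 : K) ⊗ₜ[A] KaehlerDifferential.D k A a) = 0 := by
      intro a
      obtain ⟨f, rfl⟩ := hπ a
      rw [hd, hℓ]
      simp
    have hz' : ℓ.restrictScalars A ∘ₗ (TensorProduct.mk A K (Ω[A⁄k]) 1) = 0 := by
      refine LinearMap.ext_on (KaehlerDifferential.span_range_derivation k A) ?_
      rintro _ ⟨a, rfl⟩
      exact hz a
    refine TensorProduct.AlgebraTensorModule.curry_injective ?_
    refine LinearMap.ext_ring (LinearMap.ext fun w => ?_)
    exact LinearMap.congr_fun hz' w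
  have hrange : LinearMap.range Φ =
      tangentSpace ((algebraMap A K).comp π.toRingHom) (RingHom.ker π) := by
    refine le_antisymm ?_ ?_
    · rintro _ ⟨ℓ, rfl⟩ f hf
      rw [← hd, (show π f = 0 from hf)]
      simp
    · intro v hv
      let L : MvPolynomial ι k →ₗ[k] K :=
        { toFun := fun f => ∑ j, v j * ((algebraMap A K).comp π.toRingHom) (MvPolynomial.pderiv j f)
          map_add' := fun f g => by simp [mul_add, Finset.sum_add_distrib]
          map_smul' := fun c f => by
            simp only [Finset.smul_sum, RingHom.id_apply, RingHom.comp_apply]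
            refine Finset.sum_congr rfl fun j _ => ?_
            have : π.toRingHom (c • MvPolynomial.pderiv j f) =
              c • π.toRingHom (MvPolynomial.pderiv j f) := map_smul π _ _
            rw [Derivation.map_smul, this, Algebra.smul_def, map_mul, ← IsScalarTower.algebraMap_apply,
              Algebra.smul_def]
            ring }
      have hLker : LinearMap.ker π.toLinearMap ≤ LinearMap.ker L := fun f hf => hv f hf
      obtain ⟨δ, hδ⟩ : ∃ δ : A →ₗ[k] K, ∀ f, δ (π f) = L f := by
        obtain ⟨σ, hσ⟩ := π.toLinearMap.exists_rightInverse_of_surjective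
          (LinearMap.range_eq_top.2 hπ)
        refine ⟨L ∘ₗ σ, fun f => ?_⟩
        have : σ (π f) - f ∈ LinearMap.ker π.toLinearMap := by
          have := LinearMap.congr_fun hσ (π f)
          simp only [LinearMap.comp_apply, LinearMap.id_apply, AlgHom.toLinearMap_apply] at this
          simp [this]
        have := hLker this
        rw [LinearMap.mem_ker, map_sub, sub_eq_zero] at this
        exact this
      let d : Derivation k A K := Derivation.mk' δ (by
        intro a b
        obtain ⟨f, rfl⟩ := hπ a
        obtain ⟨g, rfl⟩ := hπ b
        rw [← map_mul, hδ, hδ, hδ, Algebra.smul_def, Algebra.smul_def]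
        exact MvPolynomial.sum_pderiv_leibniz ((algebraMap A K).comp π.toRingHom) v f g)
      refine ⟨d.liftKaehlerDifferential.liftBaseChange K, ?_⟩
      ext j
      rw [hΦ, LinearMap.liftBaseChange_tmul, one_smul, Derivation.liftKaehlerDifferential_comp_D]
      change δ _ = _
      rw [hδ]
      classical
      change ∑ i, v i * ((algebraMap A K).comp π.toRingHom) (MvPolynomial.pderiv i _) = _
      rw [Finset.sum_eq_single j]
      · simp
      · intro i _ hi
        simp [MvPolynomial.pderiv_X, Pi.single_eq_of_ne hi.symm]
      · simp
  have : Algebra.FiniteType k A := Algebra.FiniteType.of_surjective π hπ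
  rw [← hrange, LinearMap.finrank_range_of_inj hinj, Module.finrank_linearMap_self]
  exact finrank_tensor_kaehlerDifferential g hg hint

/-- Linear independence of a family of polynomial vectors, after specialisation to a field, is
witnessed by a maximal minor. -/
theorem linearIndependent_map_iff_exists_minor {R F ι : Type*} [CommRing R] [Field F] [Fintype ι]
    (φ : R →+* F) {r : ℕ} (u : Fin r → ι → R) :
    LinearIndependent F (fun i j => φ (u i j)) ↔
      ∃ e : Fin r → ι, φ (Matrix.det (Matrix.of fun i l => u i (e l))) ≠ 0 := by
  have hdet : ∀ e : Fin r → ι, φ (Matrix.det (Matrix.of fun i l => u i (e l))) =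
      Matrix.det (Matrix.of fun i l => φ (u i (e l))) := fun e => by
    rw [RingHom.map_det]
    rfl
  simp only [hdet]
  constructor
  · intro h
    set B : Matrix (Fin r) ι F := Matrix.of fun i j => φ (u i j)
    have hB : B.rank = r := by
      have h' : LinearIndependent F B.row := h
      rw [h'.rank_matrix, Fintype.card_fin]
    rw [Matrix.rank_eq_finrank_span_cols] at hB
    have hcols := Submodule.exists_fun_fin_finrank_span_eq F (Set.range B.col)
    rw [hB] at hcols
    obtain ⟨c, hc, -, hli⟩ := hcols
    choose e he using hc
    refine ⟨e, ?_⟩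
    have hcol : LinearIndependent F (Matrix.of fun i l => φ (u i (e l))).col := by
      have : (Matrix.of fun i l => φ (u i (e l))).col = c := by
        ext l i
        rw [← he]
        rfl
      rwa [this]
    rw [Matrix.linearIndependent_cols_iff_isUnit, Matrix.isUnit_iff_isUnit_det] at hcol
    exact hcol.ne_zero
  · rintro ⟨e, he⟩
    have hrow : LinearIndependent F (Matrix.of fun i l => φ (u i (e l))).row := by
      rw [Matrix.linearIndependent_rows_iff_isUnit, Matrix.isUnit_iff_isUnit_det]
      exact he.isUnit
    exact LinearIndependent.of_comp (LinearMap.funLeft F F e) hrow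

theorem le_finrank_iff_exists_linearIndependent {k E : Type*} [Field k] [AddCommGroup E]
    [Module k E] [FiniteDimensional k E] {W : Submodule k E} {r : ℕ} :
    r ≤ finrank k W ↔ ∃ v : Fin r → E, (∀ i, v i ∈ W) ∧ LinearIndependent k v := by
  constructor
  · intro h
    refine ⟨fun i => finBasis k W (Fin.castLE h i), fun i => (finBasis k W _).2, ?_⟩
    exact ((finBasis k W).linearIndependent.comp _ (Fin.castLE_injective h)).map'
      W.subtype (Submodule.ker_subtype W)
  · rintro ⟨v, hv, hli⟩
    have : LinearIndependent k fun i => (⟨v i, hv i⟩ : W) :=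
      LinearIndependent.of_comp W.subtype hli
    simpa using this.fintype_card_le_finrank

/-- Coordinatewise evaluation of polynomial vectors at a point. -/
def evalVec {ι : Type*} (x : ι → ℂ) : (ι → MvPolynomial ι ℂ) →ₗ[ℂ] (ι → ℂ) :=
  (MvPolynomial.aeval x).toLinearMap.compLeft ι

@[simp]
theorem evalVec_apply {ι : Type*} (x : ι → ℂ) (u : ι → MvPolynomial ι ℂ) (j : ι) :
    evalVec x u j = MvPolynomial.eval x (u j) := by
  simp [evalVec, MvPolynomial.aeval_eq_eval]

theorem le_finrank_map_evalVec_iff {ι : Type*} [Fintype ι] (x : ι → ℂ)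
    (M : Submodule ℂ (ι → MvPolynomial ι ℂ)) (r : ℕ) :
    r ≤ finrank ℂ (M.map (evalVec x)) ↔ ∃ u : Fin r → ι → MvPolynomial ι ℂ, (∀ i, u i ∈ M) ∧
      ∃ e : Fin r → ι,
        MvPolynomial.eval x (Matrix.det (Matrix.of fun i l => u i (e l))) ≠ 0 := by
  rw [le_finrank_iff_exists_linearIndependent]
  constructor
  · rintro ⟨v, hv, hli⟩
    choose u hu huv using hv
    refine ⟨u, hu, (linearIndependent_map_iff_exists_minor _ u).1 ?_⟩
    have huv' : (fun i j => MvPolynomial.eval x (u i j)) = v := by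
      ext i j
      rw [← huv, evalVec_apply]
    rwa [huv']
  · rintro ⟨u, hu, he⟩
    refine ⟨fun i => evalVec x (u i), fun i => ⟨u i, hu i, rfl⟩, ?_⟩
    have huv : (fun i => evalVec x (u i)) = fun i j => MvPolynomial.eval x (u i j) := by
      ext i j
      simp
    rw [huv]
    exact (linearIndependent_map_iff_exists_minor _ u).2 he

/-- The polynomial vector fields tangent to the zero locus of `P`. -/
def tangentFields {ι : Type*} [Fintype ι] (P : Ideal (MvPolynomial ι ℂ)) :
    Submodule ℂ (ι → MvPolynomial ι ℂ) where
  carrier := {u | ∀ f ∈ P, ∑ j, u j * MvPolynomial.pderiv j f ∈ P}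
  add_mem' {u w} hu hw f hf := by
    simp only [Pi.add_apply, add_mul, Finset.sum_add_distrib]
    exact P.add_mem (hu f hf) (hw f hf)
  zero_mem' f _ := by simp
  smul_mem' c u hu f hf := by
    simp only [Pi.smul_apply, smul_mul_assoc, ← Finset.smul_sum]
    exact Submodule.smul_of_tower_mem P c (hu f hf)

/-- The generic point of the zero locus of the prime ideal `P`, with values in its function
field. -/
def toFunctionField {ι : Type*} (P : Ideal (MvPolynomial ι ℂ)) [P.IsPrime] :
    MvPolynomial ι ℂ →+* FractionRing (MvPolynomial ι ℂ ⧸ P) :=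
  (algebraMap (MvPolynomial ι ℂ ⧸ P) _).comp (Ideal.Quotient.mkₐ ℂ P).toRingHom

theorem toFunctionField_eq_zero_iff {ι : Type*} {P : Ideal (MvPolynomial ι ℂ)} [P.IsPrime]
    {f : MvPolynomial ι ℂ} : toFunctionField P f = 0 ↔ f ∈ P := by
  rw [← Ideal.Quotient.eq_zero_iff_mem]
  exact map_eq_zero_iff _ (IsFractionRing.injective (MvPolynomial ι ℂ ⧸ P) _)

theorem finrank_tangentSpace_toFunctionField {ι : Type*} [Fintype ι] {P : Ideal (MvPolynomial ι ℂ)}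
    [P.IsPrime] {s : ℕ} (hs : ringKrullDim (MvPolynomial ι ℂ ⧸ P) = s) :
    finrank (FractionRing (MvPolynomial ι ℂ ⧸ P)) (tangentSpace (toFunctionField P) P) = s := by
  obtain ⟨s', g, hg, hint, hs'⟩ :=
    exists_integral_injective_ringKrullDim_eq ℂ (MvPolynomial ι ℂ ⧸ P)
  obtain rfl : s' = s := by
    rw [hs] at hs'
    exact_mod_cast hs'.symm
  have := finrank_tangentSpace_generic (K := FractionRing (MvPolynomial ι ℂ ⧸ P))
    (Ideal.Quotient.mkₐ ℂ P) (Ideal.Quotient.mkₐ_surjective ℂ P) g hg hint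
  have hker : RingHom.ker (Ideal.Quotient.mkₐ ℂ P) = P := Ideal.Quotient.mkₐ_ker ℂ P
  rwa [hker] at this

theorem finrank_map_evalVec_tangentFields_le {ι : Type*} [Fintype ι]
    {P : Ideal (MvPolynomial ι ℂ)} [P.IsPrime] {s : ℕ}
    (hs : ringKrullDim (MvPolynomial ι ℂ ⧸ P) = s) {x : ι → ℂ}
    (hx : ∀ f ∈ P, MvPolynomial.eval x f = 0) :
    finrank ℂ ((tangentFields P).map (evalVec x)) ≤ s := by
  obtain ⟨u, hu, e, he⟩ := (le_finrank_map_evalVec_iff x (tangentFields P) _).1 le_rfl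
  rw [← finrank_tangentSpace_toFunctionField hs, le_finrank_iff_exists_linearIndependent]
  refine ⟨fun i j => toFunctionField P (u i j), fun i f hf => ?_,
    (linearIndependent_map_iff_exists_minor _ u).2 ⟨e, fun h => ?_⟩⟩
  · simp only [← map_mul, ← map_sum]
    exact toFunctionField_eq_zero_iff.2 (hu i f hf)
  · exact he (hx _ (toFunctionField_eq_zero_iff.1 h))

theorem exists_le_finrank_map_evalVec_tangentFields {ι : Type*} [Fintype ι]
    {S : Set (ι → ℂ)} [(MvPolynomial.vanishingIdeal ℂ S).IsPrime] {s : ℕ}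
    (hs : ringKrullDim (MvPolynomial ι ℂ ⧸ MvPolynomial.vanishingIdeal ℂ S) = s) :
    ∃ x ∈ S, s ≤ finrank ℂ
      ((tangentFields (MvPolynomial.vanishingIdeal ℂ S)).map (evalVec x)) := by
  set P := MvPolynomial.vanishingIdeal ℂ S with hP
  obtain ⟨v, hv, hli⟩ := le_finrank_iff_exists_linearIndependent.1
    (finrank_tangentSpace_toFunctionField hs).ge
  obtain ⟨b, hb⟩ := IsLocalization.exist_integer_multiples_of_finite
    (nonZeroDivisors (MvPolynomial ι ℂ ⧸ P)) (fun q : Fin s × ι => v q.1 q.2)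
  have hlift : ∀ q : Fin s × ι, ∃ f : MvPolynomial ι ℂ,
      toFunctionField P f = algebraMap (MvPolynomial ι ℂ ⧸ P) _ (b : MvPolynomial ι ℂ ⧸ P) *
        v q.1 q.2 := by
    intro q
    obtain ⟨a, ha⟩ := hb q
    obtain ⟨f, rfl⟩ := Ideal.Quotient.mk_surjective a
    exact ⟨f, ha.trans (Algebra.smul_def _ _)⟩
  choose u hu using hlift
  have hb0 : algebraMap (MvPolynomial ι ℂ ⧸ P) (FractionRing (MvPolynomial ι ℂ ⧸ P))
      (b : MvPolynomial ι ℂ ⧸ P) ≠ 0 :=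
    IsFractionRing.to_map_ne_zero_of_mem_nonZeroDivisors b.2
  have hli' : LinearIndependent (FractionRing (MvPolynomial ι ℂ ⧸ P))
      fun i j => toFunctionField P (u (i, j)) := by
    have huv : (fun i j => toFunctionField P (u (i, j))) =
        (fun _ => Units.mk0 _ hb0 : Fin s → _) • v := by
      ext i j
      simp [hu, Units.smul_def]
    rw [huv]
    exact hli.units_smul _
  obtain ⟨e, he⟩ := (linearIndependent_map_iff_exists_minor _ fun i j => u (i, j)).1 hli'
  rw [Ne, toFunctionField_eq_zero_iff, mem_vanishingIdeal_iff_eval] at he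
  push Not at he
  obtain ⟨x, hxS, hx⟩ := he
  refine ⟨x, hxS, (le_finrank_map_evalVec_iff x _ s).2 ⟨fun i j => u (i, j), fun i f hf => ?_,
    e, hx⟩⟩
  rw [← toFunctionField_eq_zero_iff, map_sum]
  simp only [map_mul, hu, mul_assoc, ← Finset.mul_sum]
  rw [hv i f hf, mul_zero]

/-- The gradient of `f` at the `F`-valued point `φ`. -/
def polyGradient {ι k F : Type*} [Field k] [Field F] (φ : MvPolynomial ι k →+* F)
    (f : MvPolynomial ι k) : ι → F :=
  fun j => φ (MvPolynomial.pderiv j f)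

theorem finrank_span_add_finrank_orthogonal {ι F : Type*} [Fintype ι] [Field F]
    (S : Set (ι → F)) (T : Submodule F (ι → F))
    (hT : ∀ v, v ∈ T ↔ ∀ w ∈ S, w ⬝ᵥ v = 0) :
    finrank F (Submodule.span F S) + finrank F T = Fintype.card ι := by
  classical
  have h := Subspace.finrank_add_finrank_dualCoannihilator_eq
    ((Submodule.span F S).map (dotProductEquiv F ι).toLinearMap)
  rw [LinearEquiv.finrank_map_eq, finrank_fintype_fun_eq_card] at h
  suffices T = ((Submodule.span F S).map (dotProductEquiv F ι).toLinearMap).dualCoannihilator by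
    rw [this, h]
  ext v
  rw [hT, Submodule.mem_dualCoannihilator]
  constructor
  · rintro hv _ ⟨w, hw, rfl⟩
    change w ⬝ᵥ v = 0
    induction hw using Submodule.span_induction with
    | mem w hw => exact hv w hw
    | zero => simp
    | add a b _ _ ha hb => rw [add_dotProduct, ha, hb, add_zero]
    | smul c a _ ha => rw [smul_dotProduct, ha, smul_zero]
  · intro hv w hw
    exact hv _ ⟨w, Submodule.subset_span hw, rfl⟩

theorem finrank_span_gradient_add_finrank_tangentSpace {ι k F : Type*} [Fintype ι] [Field k]
    [Field F] (φ : MvPolynomial ι k →+* F) (P : Ideal (MvPolynomial ι k)) :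
    finrank F (Submodule.span F (polyGradient φ '' P)) + finrank F (tangentSpace φ P) =
      Fintype.card ι := by
  refine finrank_span_add_finrank_orthogonal _ _ fun v => ?_
  rw [mem_tangentSpace, Set.forall_mem_image]
  simp only [dotProduct, polyGradient, mul_comm, SetLike.mem_coe]

/-- On a nonempty open subset of an irreducible variety, the Zariski tangent space has at most the
dimension of the variety. -/
theorem exists_notMem_finrank_tangentSpace_le {ι : Type*} [Fintype ι]
    {P : Ideal (MvPolynomial ι ℂ)} [P.IsPrime] {s : ℕ}
    (hs : ringKrullDim (MvPolynomial ι ℂ ⧸ P) = s) :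
    ∃ h ∉ P, ∀ x : ι → ℂ, MvPolynomial.eval x h ≠ 0 →
      finrank ℂ (tangentSpace (MvPolynomial.eval x) P) ≤ s := by
  have hdim := finrank_span_gradient_add_finrank_tangentSpace (toFunctionField P) P
  rw [finrank_tangentSpace_toFunctionField hs] at hdim
  obtain ⟨c, hc, -, hli⟩ := Submodule.exists_fun_fin_finrank_span_eq
    (FractionRing (MvPolynomial ι ℂ ⧸ P)) (polyGradient (toFunctionField P) '' (P : Set _))
  choose f hfP hf using hc
  have hli' : LinearIndependent (FractionRing (MvPolynomial ι ℂ ⧸ P))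
      fun i j => toFunctionField P (MvPolynomial.pderiv j (f i)) := by
    have hc : (fun i j => toFunctionField P (MvPolynomial.pderiv j (f i))) = c := by
      ext i j
      rw [← hf]
      rfl
    rwa [hc]
  obtain ⟨e, he⟩ := (linearIndependent_map_iff_exists_minor _
    fun i j => MvPolynomial.pderiv j (f i)).1 hli'
  rw [Ne, toFunctionField_eq_zero_iff] at he
  refine ⟨_, he, fun x hx => ?_⟩
  have hx' := (linearIndependent_map_iff_exists_minor (MvPolynomial.eval x)
    fun i j => MvPolynomial.pderiv j (f i)).2 ⟨e, hx⟩
  have hle : finrank (FractionRing (MvPolynomial ι ℂ ⧸ P))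
      (Submodule.span (FractionRing (MvPolynomial ι ℂ ⧸ P))
        (polyGradient (toFunctionField P) '' (P : Set _))) ≤
      finrank ℂ (Submodule.span ℂ (polyGradient (MvPolynomial.eval x) '' (P : Set _))) :=
    le_finrank_iff_exists_linearIndependent.2
      ⟨_, fun i => Submodule.subset_span ⟨f i, hfP i, rfl⟩, hx'⟩
  have := finrank_span_gradient_add_finrank_tangentSpace (MvPolynomial.eval x) P
  omega

/-- The chain rule for polynomial substitutions. -/
theorem MvPolynomial.sum_pderiv_bind₁ {ι κ k S : Type*} [Fintype ι] [Fintype κ] [CommRing k]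
    [CommRing S] (ψ : MvPolynomial κ k →+* S) (v : κ → S) (φ : ι → MvPolynomial κ k)
    (f : MvPolynomial ι k) :
    ∑ l, v l * ψ (pderiv l (bind₁ φ f)) =
      ∑ j, (∑ l, v l * ψ (pderiv l (φ j))) * ψ (bind₁ φ (pderiv j f)) := by
  have := eq_sum_pderiv_of_leibniz (ψ.comp (bind₁ φ).toRingHom)
    (fun f => ∑ l, v l * ψ (pderiv l (bind₁ φ f))) (fun a => by simp)
    (fun f g => by simp [mul_add, Finset.sum_add_distrib])
    (fun f g => by
      simp only [map_mul, RingHom.comp_apply]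
      exact sum_pderiv_leibniz ψ v _ _) f
  simpa using this

theorem MvPolynomial.eval_bind₁ {ι κ k : Type*} [CommRing k] (φ : ι → MvPolynomial κ k)
    (x : κ → k) (f : MvPolynomial ι k) :
    eval x (bind₁ φ f) = eval (fun j => eval x (φ j)) f := by
  simp [← MvPolynomial.aeval_eq_eval, MvPolynomial.aeval_bind₁]

/-- Lower semicontinuity of the rank of a family of polynomial vector fields. -/
theorem isOpen_le_finrank_map_evalVec_sup {ι : Type*} [Fintype ι]
    (M : Submodule ℂ (ι → MvPolynomial ι ℂ)) (W : Submodule ℂ (ι → ℂ)) (r : ℕ) :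
    @IsOpen _ (zt ι) {x | r ≤ finrank ℂ ↥(M.map (evalVec x) ⊔ W)} := by
  let _ := zt ι
  let c : (ι → ℂ) →ₗ[ℂ] (ι → MvPolynomial ι ℂ) :=
    (Algebra.linearMap ℂ (MvPolynomial ι ℂ)).compLeft ι
  have hc : ∀ x, (M ⊔ W.map c).map (evalVec x) = M.map (evalVec x) ⊔ W := fun x => by
    have : evalVec x ∘ₗ c = LinearMap.id := by
      ext v j
      simp [c, MvPolynomial.algebraMap_eq]
    rw [Submodule.map_sup, ← Submodule.map_comp, this, Submodule.map_id]
  have hset : {x | r ≤ finrank ℂ ↥(M.map (evalVec x) ⊔ W)} =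
      ⋃ u : {u : Fin r → ι → MvPolynomial ι ℂ // ∀ i, u i ∈ M ⊔ W.map c}, ⋃ e : Fin r → ι,
        {x | MvPolynomial.eval x (Matrix.det (Matrix.of fun i l => u.1 i (e l))) ≠ 0} := by
    ext x
    have h := le_finrank_map_evalVec_iff x (M ⊔ W.map c) r
    rw [hc] at h
    simpa using h
  rw [hset]
  exact isOpen_iUnion fun u => isOpen_iUnion fun e => isOpen_eval_ne_zero _

/-- Vector fields tangent to an invariant variety are transported by linear automorphisms. -/
theorem map_map_evalVec_tangentFields_le {ι : Type*} [Fintype ι] {V : Set (ι → ℂ)}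
    (L : (ι → ℂ) ≃ₗ[ℂ] (ι → ℂ)) (hL : ∀ x ∈ V, L x ∈ V) (hL' : ∀ x ∈ V, L.symm x ∈ V)
    (x : ι → ℂ) :
    ((tangentFields (MvPolynomial.vanishingIdeal ℂ V)).map (evalVec x)).map
        (L : (ι → ℂ) →ₗ[ℂ] (ι → ℂ)) ≤
      (tangentFields (MvPolynomial.vanishingIdeal ℂ V)).map (evalVec (L x)) := by
  classical
  have hmat : ∀ (A : (ι → ℂ) ≃ₗ[ℂ] (ι → ℂ)) (v : ι → ℂ) (j : ι),
      ∑ l, v l * A (Pi.single l 1) j = A v j := fun A v j => by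
    conv_rhs => rw [pi_eq_sum_univ' v, map_sum, Finset.sum_apply]
    simp [Pi.single]
  let form (A : (ι → ℂ) ≃ₗ[ℂ] (ι → ℂ)) (j : ι) : MvPolynomial ι ℂ :=
    ∑ l, MvPolynomial.X l * MvPolynomial.C (A (Pi.single l 1) j)
  have hform : ∀ A x, (fun j => MvPolynomial.eval x (form A j)) = A x := fun A x => by
    ext j
    simp [form, hmat]
  rintro _ ⟨_, ⟨u, hu, rfl⟩, rfl⟩
  refine ⟨fun j => ∑ l, MvPolynomial.bind₁ (form L.symm) (u l) *
    MvPolynomial.C (L (Pi.single l 1) j), ?_, ?_⟩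
  · intro f hf
    rw [mem_vanishingIdeal_iff_eval] at hf ⊢
    intro y hy
    have hmem : MvPolynomial.bind₁ (form L) f ∈ MvPolynomial.vanishingIdeal ℂ V := by
      rw [mem_vanishingIdeal_iff_eval]
      intro z hz
      rw [MvPolynomial.eval_bind₁, hform]
      exact hf _ (hL z hz)
    have := mem_vanishingIdeal_iff_eval.1 (hu _ hmem) _ (hL' y hy)
    simp only [map_sum, map_mul] at this
    rw [MvPolynomial.sum_pderiv_bind₁] at this
    rw [← this]
    simp only [map_sum, map_mul, MvPolynomial.eval_bind₁, hform, LinearEquiv.apply_symm_apply,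
      MvPolynomial.eval_C]
    refine Finset.sum_congr rfl fun j _ => ?_
    congr 1
    refine Finset.sum_congr rfl fun l _ => ?_
    simp [form, MvPolynomial.pderiv_X, Pi.single_apply]
  · ext j
    simp only [evalVec_apply, map_sum, map_mul, MvPolynomial.eval_bind₁, hform,
      LinearEquiv.symm_apply_apply, MvPolynomial.eval_C, LinearEquiv.coe_coe]
    rw [← hmat]
    simp

theorem map_evalVec_tangentFields_eq {ι : Type*} [Fintype ι] {V : Set (ι → ℂ)}
    (L : (ι → ℂ) ≃ₗ[ℂ] (ι → ℂ)) (hL : ∀ x ∈ V, L x ∈ V) (hL' : ∀ x ∈ V, L.symm x ∈ V)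
    (x : ι → ℂ) :
    (tangentFields (MvPolynomial.vanishingIdeal ℂ V)).map (evalVec (L x)) =
      ((tangentFields (MvPolynomial.vanishingIdeal ℂ V)).map (evalVec x)).map
        (L : (ι → ℂ) →ₗ[ℂ] (ι → ℂ)) := by
  refine le_antisymm (fun v hv => ?_) (map_map_evalVec_tangentFields_le L hL hL' x)
  have := map_map_evalVec_tangentFields_le L.symm hL' hL (L x) ⟨v, hv, rfl⟩
  rw [LinearEquiv.symm_apply_apply] at this
  exact ⟨_, this, by simp⟩

/-- The condition that a polynomial does not vanish on a tuple of points is separately open. -/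
theorem sepOpen_eval_ne_zero {ι κ : Type*} [DecidableEq κ] {V : Set (ι → ℂ)}
    (f : MvPolynomial (κ × ι) ℂ) :
    let _ := zt ι
    SepOpen {y : κ → V | MvPolynomial.eval (fun p => (y p.1 : ι → ℂ) p.2) f ≠ 0} := by
  intro _ y i
  let φ (p : κ × ι) : MvPolynomial ι ℂ :=
    if p.1 = i then MvPolynomial.X p.2 else MvPolynomial.C ((y p.1 : ι → ℂ) p.2)
  convert (isOpen_eval_ne_zero (MvPolynomial.bind₁ φ f)).preimage continuous_subtype_val using 1
  ext v
  simp only [Set.mem_ofPred_eq, Set.mem_preimage, MvPolynomial.eval_bind₁]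
  have : (fun p : κ × ι => (Function.update y i v p.1 : ι → ℂ) p.2) =
      fun p => MvPolynomial.eval (v : ι → ℂ) (φ p) := by
    ext p
    by_cases h : p.1 = i <;> simp [φ, h]
  rw [this]

/-- A Cartesian power of an irreducible variety. -/
def tuples (κ : Type*) {ι : Type*} (V : Set (ι → ℂ)) : Set (κ × ι → ℂ) :=
  {p | ∀ i, (fun j => p (i, j)) ∈ V}

theorem isPrime_vanishingIdeal_tuples {ι κ : Type*} [Finite κ] {V : Set (ι → ℂ)}
    (hV : zIsIrreducible V) : (MvPolynomial.vanishingIdeal ℂ (tuples κ V)).IsPrime := by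
  classical
  let _ := zt ι
  have : PreirreducibleSpace V := Subtype.preirreducibleSpace hV.2
  obtain ⟨x, hx⟩ := hV.1
  have hne : ∀ f : MvPolynomial (κ × ι) ℂ, f ∉ MvPolynomial.vanishingIdeal ℂ (tuples κ V) →
      {y : κ → V | MvPolynomial.eval (fun p => (y p.1 : ι → ℂ) p.2) f ≠ 0}.Nonempty := by
    intro f hf
    rw [mem_vanishingIdeal_iff_eval] at hf
    push Not at hf
    obtain ⟨p, hp, hpf⟩ := hf
    exact ⟨fun i => ⟨_, hp i⟩, hpf⟩
  refine ⟨fun h => ?_, fun {f g} hfg => ?_⟩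
  · have h1 : (1 : MvPolynomial (κ × ι) ℂ) ∈ MvPolynomial.vanishingIdeal ℂ (tuples κ V) :=
      h ▸ Submodule.mem_top
    simpa using mem_vanishingIdeal_iff_eval.1 h1 (fun p => x p.2) fun _ => hx
  · by_contra! hcon
    obtain ⟨y, hyf, hyg⟩ := SepOpen.inter_nonempty (sepOpen_eval_ne_zero f)
      (sepOpen_eval_ne_zero g) (hne f hcon.1) (hne g hcon.2)
    have := mem_vanishingIdeal_iff_eval.1 hfg (fun p => (y p.1 : ι → ℂ) p.2) fun i => (y i).2
    rw [map_mul] at this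
    exact mul_ne_zero hyf hyg this

/-- The comorphism of the addition map on tuples of points. -/
def sumHom (κ ι : Type*) [Fintype κ] : MvPolynomial ι ℂ →ₐ[ℂ] MvPolynomial (κ × ι) ℂ :=
  MvPolynomial.bind₁ fun j => ∑ i, MvPolynomial.X (i, j)

theorem eval_sumHom {κ ι : Type*} [Fintype κ] (p : κ × ι → ℂ) (f : MvPolynomial ι ℂ) :
    MvPolynomial.eval p (sumHom κ ι f) = MvPolynomial.eval (∑ i, fun j => p (i, j)) f := by
  rw [sumHom, MvPolynomial.eval_bind₁]
  congr 2
  ext j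
  simp

theorem mem_vanishingIdeal_secant {ι : Type*} {m : ℕ} {V : Set (ι → ℂ)} {f : MvPolynomial ι ℂ} :
    f ∈ MvPolynomial.vanishingIdeal ℂ (secant m V) ↔
      ∀ y : Fin m → V, MvPolynomial.eval (∑ i, (y i : ι → ℂ)) f = 0 := by
  rw [secant, vanishingIdeal_zClosure, mem_vanishingIdeal_iff_eval]
  constructor
  · exact fun h y => h _ ⟨fun i => y i, fun i => (y i).2, rfl⟩
  · rintro h _ ⟨x, hx, rfl⟩
    exact h fun i => ⟨x i, hx i⟩

theorem vanishingIdeal_secant {ι : Type*} (m : ℕ) (V : Set (ι → ℂ)) :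
    MvPolynomial.vanishingIdeal ℂ (secant m V) =
      (MvPolynomial.vanishingIdeal ℂ (tuples (Fin m) V)).comap (sumHom (Fin m) ι) := by
  ext f
  rw [mem_vanishingIdeal_secant, Ideal.mem_comap, mem_vanishingIdeal_iff_eval]
  constructor
  · intro h p hp
    rw [eval_sumHom]
    exact h fun i => ⟨_, hp i⟩
  · intro h y
    have := h (fun p => (y p.1 : ι → ℂ) p.2) fun i => (y i).2
    rwa [eval_sumHom] at this

theorem isPrime_vanishingIdeal_secant {ι : Type*} (m : ℕ) {V : Set (ι → ℂ)}
    (hV : zIsIrreducible V) : (MvPolynomial.vanishingIdeal ℂ (secant m V)).IsPrime := by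
  have := isPrime_vanishingIdeal_tuples (κ := Fin m) hV
  rw [vanishingIdeal_secant]
  exact Ideal.comap_isPrime _ _

/-- A domain generated by the images of `κ` copies of an algebra that is integral over a polynomial
ring in `N` variables contains at most `#κ * N` algebraically independent elements. -/
theorem le_card_mul_of_injective {κ k A B : Type*} [Fintype κ] [Field k] [CommRing A] [CommRing B]
    [IsDomain B] [Algebra k A] [Algebra k B] {N r : ℕ} (g : MvPolynomial (Fin N) k →ₐ[k] A)
    (hg : g.IsIntegral) (e : κ → A →ₐ[k] B) (he : ⨆ i, (e i).range = ⊤)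
    (h : MvPolynomial (Fin r) k →ₐ[k] B) (hh : Function.Injective h) :
    r ≤ Fintype.card κ * N := by
  set b : κ × Fin N → B := fun p => e p.1 (g (MvPolynomial.X p.2))
  set C := Algebra.adjoin k (Set.range b)
  have hint : ∀ i a, IsIntegral C (e i a) := by
    intro i a
    have hrange : ∀ p, ((e i).comp g) p ∈ C := by
      intro p
      have : (e i).comp g = MvPolynomial.aeval fun l => b (i, l) := by
        ext l
        simp [b]
      rw [this]
      have := (MvPolynomial.aeval (R := k) fun l => b (i, l)).mem_range_self p
      rw [← Algebra.adjoin_range_eq_range_aeval] at this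
      refine Algebra.adjoin_mono ?_ this
      rintro _ ⟨l, rfl⟩
      exact ⟨(i, l), rfl⟩
    have := (hg a).map (e i).toRingHom
    have hcomp : (e i).toRingHom.comp g.toRingHom =
        (algebraMap C B).comp (((e i).comp g).codRestrict C hrange).toRingHom := by
      ext <;> rfl
    exact RingHom.IsIntegralElem.of_comp (f := (((e i).comp g).codRestrict C hrange).toRingHom)
      (hcomp ▸ this)
  have htop : (⊤ : Subalgebra k B) ≤ (integralClosure C B).restrictScalars k := by
    rw [← he]
    refine iSup_le fun i => ?_
    rintro _ ⟨a, rfl⟩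
    exact hint i a
  have : Algebra.IsAlgebraic C B :=
    ⟨fun x => (show IsIntegral C x from htop (Algebra.mem_top (x := x))).isAlgebraic⟩
  have h1 := Algebra.IsAlgebraic.trdeg_le_cardinalMk k (Set.range b)
  have hindep : AlgebraicIndependent k fun l => h (MvPolynomial.X l) := by
    rw [algebraicIndependent_iff_injective_aeval]
    have : MvPolynomial.aeval (fun l => h (MvPolynomial.X l)) = h := by
      ext l
      simp
    rwa [this]
  have h2 := hindep.lift_cardinalMk_le_trdeg
  have h3 : Cardinal.mk (Set.range b) ≤ (Fintype.card κ * N : ℕ) := by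
    classical
    rw [Cardinal.mk_fintype]
    exact_mod_cast (Fintype.card_range_le b).trans_eq (by simp)
  have h4 := h2.trans (Cardinal.lift_le.{0}.2 (h1.trans h3))
  simp only [Cardinal.mk_fin, Cardinal.lift_natCast] at h4
  exact_mod_cast h4

theorem map_evalVec_tangentFields_le_tangentSpace_secant {ι : Type*} [Fintype ι] {m : ℕ}
    {V : Set (ι → ℂ)} (y : Fin m → V) (i : Fin m) :
    (tangentFields (MvPolynomial.vanishingIdeal ℂ V)).map (evalVec (y i : ι → ℂ)) ≤
      tangentSpace (MvPolynomial.eval (∑ k, (y k : ι → ℂ)))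
        (MvPolynomial.vanishingIdeal ℂ (secant m V)) := by
  classical
  set c : ι → ℂ := ∑ k ∈ Finset.univ.erase i, (y k : ι → ℂ)
  have hsum : ∀ z : V, ∑ k, (Function.update y i z k : ι → ℂ) = z + c := fun z => by
    rw [← Finset.add_sum_erase _ _ (Finset.mem_univ i), Function.update_self]
    congr 1
    exact Finset.sum_congr rfl fun k hk => by
      rw [Function.update_of_ne (Finset.ne_of_mem_erase hk)]
  let φ (j : ι) : MvPolynomial ι ℂ := MvPolynomial.X j + MvPolynomial.C (c j)
  have hφ : ∀ z, (fun j => MvPolynomial.eval z (φ j)) = z + c := fun z => by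
    ext j
    simp [φ]
  rintro _ ⟨u, hu, rfl⟩ f hf
  have hmem : MvPolynomial.bind₁ φ f ∈ MvPolynomial.vanishingIdeal ℂ V := by
    rw [mem_vanishingIdeal_iff_eval]
    intro z hz
    rw [MvPolynomial.eval_bind₁, hφ, ← hsum ⟨z, hz⟩]
    exact mem_vanishingIdeal_secant.1 hf _
  have hzero := mem_vanishingIdeal_iff_eval.1 (hu _ hmem) _ (y i).2
  simp only [map_sum, map_mul] at hzero
  rw [MvPolynomial.sum_pderiv_bind₁] at hzero
  have hy := hsum (y i)
  rw [Function.update_eq_self] at hy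
  rw [← hzero, hy]
  refine Finset.sum_congr rfl fun j _ => ?_
  rw [MvPolynomial.eval_bind₁, hφ]
  congr 1
  simp [φ, MvPolynomial.pderiv_X, Pi.single_apply]

/-- The dimension of the `m`-th secant variety of an irreducible variety of dimension `N` is at most
`m * N`. -/
theorem ringKrullDim_secant_le {ι : Type*} [Finite ι] {V : Set (ι → ℂ)} (hV : zIsIrreducible V)
    {m N r : ℕ} (hN : ringKrullDim (MvPolynomial ι ℂ ⧸ MvPolynomial.vanishingIdeal ℂ V) = N)
    (hr : ringKrullDim (MvPolynomial ι ℂ ⧸ MvPolynomial.vanishingIdeal ℂ (secant m V)) = r) :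
    r ≤ m * N := by
  have hI := zIsIrreducible_iff.1 hV
  have hQ := isPrime_vanishingIdeal_tuples (κ := Fin m) hV
  have hσ := isPrime_vanishingIdeal_secant m hV
  obtain ⟨N', g, -, hgint, hN'⟩ := exists_integral_injective_ringKrullDim_eq ℂ
    (MvPolynomial ι ℂ ⧸ MvPolynomial.vanishingIdeal ℂ V)
  obtain rfl : N' = N := by
    rw [hN] at hN'
    exact_mod_cast hN'.symm
  obtain ⟨r', h, hhinj, -, hr'⟩ := exists_integral_injective_ringKrullDim_eq ℂ
    (MvPolynomial ι ℂ ⧸ MvPolynomial.vanishingIdeal ℂ (secant m V))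
  obtain rfl : r' = r := by
    rw [hr] at hr'
    exact_mod_cast hr'.symm
  let e (i : Fin m) : (MvPolynomial ι ℂ ⧸ MvPolynomial.vanishingIdeal ℂ V) →ₐ[ℂ]
      MvPolynomial (Fin m × ι) ℂ ⧸ MvPolynomial.vanishingIdeal ℂ (tuples (Fin m) V) :=
    Ideal.quotientMapₐ _ (MvPolynomial.rename (Prod.mk i)) fun f hf => by
      rw [Ideal.mem_comap, mem_vanishingIdeal_iff_eval]
      intro p hp
      rw [MvPolynomial.eval_rename]
      exact mem_vanishingIdeal_iff_eval.1 hf _ (hp i)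
  have he : ⨆ i, (e i).range = ⊤ := by
    have hmap := Algebra.map_top (Ideal.Quotient.mkₐ ℂ
      (MvPolynomial.vanishingIdeal ℂ (tuples (Fin m) V)))
    rw [(AlgHom.range_eq_top _).2 (Ideal.Quotient.mkₐ_surjective ℂ _),
      ← MvPolynomial.adjoin_range_X, AlgHom.map_adjoin] at hmap
    rw [eq_top_iff, ← hmap, Algebra.adjoin_le_iff]
    rintro _ ⟨_, ⟨p, rfl⟩, rfl⟩
    refine le_iSup (fun i => (e i).range) p.1 ⟨Ideal.Quotient.mk _ (MvPolynomial.X p.2), ?_⟩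
    simp [e]
  let s : (MvPolynomial ι ℂ ⧸ MvPolynomial.vanishingIdeal ℂ (secant m V)) →ₐ[ℂ]
      MvPolynomial (Fin m × ι) ℂ ⧸ MvPolynomial.vanishingIdeal ℂ (tuples (Fin m) V) :=
    Ideal.quotientMapₐ _ (sumHom (Fin m) ι) (vanishingIdeal_secant m V).le
  have hs : Function.Injective s :=
    Ideal.quotientMap_injective' (H := (vanishingIdeal_secant m V).le)
      (vanishingIdeal_secant m V).ge
  have := le_card_mul_of_injective g hgint e he (s.comp h) (hs.comp hhinj)
  rwa [Fintype.card_fin] at this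

/-- The dimension of the `m`-th secant variety is bounded below by the dimension of the span of the
tangent spaces at `m` points. -/
theorem finrank_tupleSup_le_of_ringKrullDim_secant {ι : Type*} [Fintype ι] {V : Set (ι → ℂ)}
    (hV : zIsIrreducible V) {m r : ℕ}
    (hr : ringKrullDim (MvPolynomial ι ℂ ⧸ MvPolynomial.vanishingIdeal ℂ (secant m V)) = r)
    (x : Fin m → V) :
    finrank ℂ (tupleSup (fun v : V => (tangentFields (MvPolynomial.vanishingIdeal ℂ V)).map
      (evalVec (v : ι → ℂ))) x Finset.univ) ≤ r := by
  let _ := zt ι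
  have : PreirreducibleSpace V := Subtype.preirreducibleSpace hV.2
  have hσ := isPrime_vanishingIdeal_secant m hV
  set T : V → Submodule ℂ (ι → ℂ) := fun v =>
    (tangentFields (MvPolynomial.vanishingIdeal ℂ V)).map (evalVec (v : ι → ℂ))
  obtain ⟨h, hh, hbound⟩ := exists_notMem_finrank_tangentSpace_le hr
  rw [mem_vanishingIdeal_secant] at hh
  push Not at hh
  obtain ⟨z, hz⟩ := hh
  have hT : ∀ (W : Submodule ℂ (ι → ℂ)) (s : ℕ), IsOpen {v | s ≤ finrank ℂ ↥(T v ⊔ W)} :=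
    fun W s => (isOpen_le_finrank_map_evalVec_sup _ W s).preimage continuous_subtype_val
  obtain ⟨y, hy, hyh⟩ := SepOpen.inter_nonempty (sepOpen_finrank_tupleSup T hT Finset.univ
    (finrank ℂ (tupleSup T x Finset.univ)))
    (sepOpen_eval_ne_zero (sumHom (Fin m) ι h)) ⟨x, le_refl (finrank ℂ (tupleSup T x Finset.univ))⟩
    ⟨z, by simpa only [Set.mem_ofPred_eq, eval_sumHom] using hz⟩
  simp only [Set.mem_ofPred_eq, eval_sumHom] at hyh
  refine (show finrank ℂ (tupleSup T x Finset.univ) ≤ _ from hy).trans ?_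
  refine (Submodule.finrank_mono ?_).trans (hbound _ hyh)
  exact iSup₂_le fun i _ => map_evalVec_tangentFields_le_tangentSpace_secant y i

theorem genRank_tangentFields_one {ι : Type*} [Fintype ι] {V : Set (ι → ℂ)}
    (hV : zIsIrreducible V) {N : ℕ}
    (hN : ringKrullDim (MvPolynomial ι ℂ ⧸ MvPolynomial.vanishingIdeal ℂ V) = N) :
    genRank (fun v : V => (tangentFields (MvPolynomial.vanishingIdeal ℂ V)).map
      (evalVec (v : ι → ℂ))) 1 = N := by
  have hI := zIsIrreducible_iff.1 hV
  have : Nonempty V := hV.1.to_subtype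
  set T : V → Submodule ℂ (ι → ℂ) := fun v =>
    (tangentFields (MvPolynomial.vanishingIdeal ℂ V)).map (evalVec (v : ι → ℂ))
  have hT : ∀ y : Fin 1 → V, tupleSup T y Finset.univ = T (y 0) := fun y => by simp [tupleSup]
  refine le_antisymm ?_ ?_
  · obtain ⟨y, hy⟩ := exists_finrank_eq_genRank T 1
    rw [← hy, hT]
    exact finrank_map_evalVec_tangentFields_le hN fun f hf =>
      mem_vanishingIdeal_iff_eval.1 hf _ (y 0).2
  · obtain ⟨x, hx, hxN⟩ := exists_le_finrank_map_evalVec_tangentFields hN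
    have := finrank_tupleSup_le T (fun _ : Fin 1 => (⟨x, hx⟩ : V)) Finset.univ
    rw [hT] at this
    exact hxN.trans this

theorem stmt_5 {D : ℕ} {G : Type*} [Group G]
    (ρ : G →* ((Fin D → ℂ) ≃ₗ[ℂ] (Fin D → ℂ)))
    (hmod : IsIrreducibleGModule ρ)
    (V : Set (Fin D → ℂ))
    (hclosed : zIsClosed V) (hirr : zIsIrreducible V)
    (hcone : ∀ (c : ℂ), ∀ x ∈ V, c • x ∈ V)
    (hinv : ∀ (g : G), ∀ x ∈ V, ρ g x ∈ V)
    (hV0 : V ≠ {0})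
    (N : ℕ) (hdim : zDim V = (N : WithBot ℕ∞))
    (m : ℕ) (hm : 1 ≤ m) (hbound : N * (m + N) ≤ D) :
    zDim (secant m V) = ((m * N : ℕ) : WithBot ℕ∞) := by
  let _ := zt (Fin D)
  have : PreirreducibleSpace V := Subtype.preirreducibleSpace hirr.2
  have : Nonempty V := hirr.1.to_subtype
  rw [zDim_eq_ringKrullDim hclosed] at hdim
  have hσclosed : zIsClosed (secant m V) := isClosed_closure
  have hσ := isPrime_vanishingIdeal_secant m hirr
  obtain ⟨r, -, -, -, hr⟩ := exists_integral_injective_ringKrullDim_eq ℂ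
    (MvPolynomial (Fin D) ℂ ⧸ MvPolynomial.vanishingIdeal ℂ (secant m V))
  set T : V → Submodule ℂ (Fin D → ℂ) := fun v =>
    (tangentFields (MvPolynomial.vanishingIdeal ℂ V)).map (evalVec (v : Fin D → ℂ)) with hTdef
  have hT : ∀ (W : Submodule ℂ (Fin D → ℂ)) (s : ℕ), IsOpen {v | s ≤ finrank ℂ ↥(T v ⊔ W)} :=
    fun W s => (isOpen_le_finrank_map_evalVec_sup _ W s).preimage continuous_subtype_val
  have hsymm : ∀ g, ∀ x ∈ V, (ρ g).symm x ∈ V := fun g x hx => by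
    have := hinv g⁻¹ x hx
    rwa [map_inv] at this
  have hrank : genRank T m = m * N :=
    genRank_eq_mul (ρ := ρ) (φ := fun g v => ⟨ρ g v, hinv g v v.2⟩) hT
      (fun g v => map_evalVec_tangentFields_eq (ρ g) (hinv g) (hsymm g) v) hmod.2
      (genRank_tangentFields_one hirr hdim) hm (by simpa using hbound)
  obtain ⟨y, hy⟩ := exists_finrank_eq_genRank T m
  have hlower := finrank_tupleSup_le_of_ringKrullDim_secant hirr hr y
  have hupper := ringKrullDim_secant_le hirr hdim hr
  rw [zDim_eq_ringKrullDim hσclosed, hr]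
  have : r = m * N := le_antisymm hupper (by rw [← hrank, ← hy]; exact hlower)
  rw [this]
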